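/- arXiv:2109.03025 — 3 statements merged into one kernel-verified Lean document; each statement's English description precedes it below -/
import Mathlib

section
/- Let H = (V, μ) be a k-hypergraph of dimension d and let S be a family of k-hypergraphs of dimension d that is simple for {H}. Then H ∈ Σ_ℤ(Eqs(S)). Moreover, if |V| > 2k − 1, then V supports H for the family S. -/
/-- A hypergraph (of dimension `d`) over the data domain `ℕ`, represented by its
weight function: a finitely supported function from finite sets of data values
(potential hyperedges) to weight vectors in `ℤ^d`.  Isolated vertices are
irrelevant (hypergraphs are identified up to isolated vertices). -/
abbrev HG (d : ℕ) := (Finset ℕ) →₀ (Fin d → ℤ)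

/-- `H` is a `k`-hypergraph: every hyperedge (set with nonzero weight) has `k` elements. -/
def IsHG (k : ℕ) {d : ℕ} (H : HG d) : Prop := ∀ e ∈ H.support, e.card = k

/-- The (non-isolated) vertices of `H`: the union of its hyperedges. -/
def verts {d : ℕ} (H : HG d) : Finset ℕ := H.support.sup id

/-- The weight `w_X(H)` of a finite set `X`: the sum of the weights of all
hyperedges of `H` that contain `X`. -/
def weight {d : ℕ} (X : Finset ℕ) (H : HG d) : Fin d → ℤ :=
  ∑ e ∈ H.support.filter (fun e => X ⊆ e), H e
/-- Two hypergraphs are equivalent if (after discarding isolated vertices) they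
differ by a permutation of the data domain. -/
def HGEquiv {d : ℕ} (H₁ H₂ : HG d) : Prop :=
  ∃ π : ℕ ≃ ℕ, ∀ e : Finset ℕ, H₂ (e.image π) = H₁ e

/-- All hypergraphs equivalent to a member of the family `𝒢`. -/
def Eqs {d : ℕ} (𝒢 : Set (HG d)) : Set (HG d) := {H | ∃ G ∈ 𝒢, HGEquiv G H}

/-- `Σ_ℤ(𝒢)`: all finite `ℤ`-linear combinations of members of `𝒢`. -/
def Zsum {d : ℕ} (𝒢 : Set (HG d)) : Set (HG d) :=
  {H | ∃ (l : ℕ) (c : Fin l → ℤ) (F : Fin l → HG d),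
      (∀ i, F i ∈ 𝒢) ∧ H = ∑ i, c i • F i}
/-- `G` is an `(m, a)`-simple `k`-hypergraph:
its vertex set is (contained in) a disjoint union `A ∪ B ∪ C` with
`A = {α₁, …, α_m}`, `B = {β₁, …, β_m}` and `|C| = 2(k−m) − 1`
(`C = ∅` when `m = k`), such that
`w_X(G) = (−1)^{|B ∩ X|} · a` for every `X = {x₁, …, x_m}` with
`x_i ∈ {α_i, β_i}` for each `i`, `w_X(G) = 0` for every other `m`-element set
`X` of vertices, and `w_X(G) = 0` for every set `X` of vertices with
`|X| < m`. -/
def IsSimple {d : ℕ} (k m : ℕ) (a : Fin d → ℤ) (G : HG d) : Prop :=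
  ∃ (A B C : Finset ℕ) (α β : Fin m → ℕ),
    Function.Injective α ∧ Function.Injective β ∧
    A = Finset.image α Finset.univ ∧ B = Finset.image β Finset.univ ∧
    Disjoint A B ∧ Disjoint A C ∧ Disjoint B C ∧
    C.card = 2 * (k - m) - 1 ∧
    verts G ⊆ A ∪ B ∪ C ∧
    (∀ χ : Fin m → Bool,
      weight (Finset.image (fun i => if χ i then β i else α i) Finset.univ) G
        = ((-1 : ℤ) ^ (Finset.univ.filter (fun i => χ i = true)).card) • a) ∧
    (∀ X : Finset ℕ, X ⊆ A ∪ B ∪ C → X.card = m →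
        (∀ χ : Fin m → Bool,
          X ≠ Finset.image (fun i => if χ i then β i else α i) Finset.univ) →
        weight X G = 0) ∧
    (∀ X : Finset ℕ, X ⊆ A ∪ B ∪ C → X.card < m → weight X G = 0)

/-- `S` is a simplification of the family `𝒢`: for every `0 ≤ m ≤ k` and every
vector `g` in the `ℤ`-span of the weights of `m`-element sets of vertices of
members of `𝒢`, the family `S` contains an `(m, g)`-simple `k`-hypergraph. -/
def IsSimplificationOf {d : ℕ} (k : ℕ) (S 𝒢 : Set (HG d)) : Prop :=
  ∀ m : ℕ, m ≤ k →
    ∀ g ∈ Submodule.span ℤ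
      {w : Fin d → ℤ | ∃ G ∈ 𝒢, ∃ X : Finset ℕ,
        X ⊆ verts G ∧ X.card = m ∧ w = weight X G},
      ∃ G' ∈ S, IsSimple k m g G'

/-- `S` is self-simplified: `S` is a simplification of `S` itself. -/
def SelfSimplified {d : ℕ} (k : ℕ) (S : Set (HG d)) : Prop :=
  IsSimplificationOf k S S

/-- `S` is simple for `𝒢`: `S` is self-simplified and a simplification of `𝒢`. -/
def SimpleFor {d : ℕ} (k : ℕ) (S 𝒢 : Set (HG d)) : Prop :=
  SelfSimplified k S ∧ IsSimplificationOf k S 𝒢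
/-- A set `V` of data values supports a hypergraph `H` for the family `𝓗` if
`H = Σᵢ aᵢ · Hᵢ` for some integers `aᵢ` and hypergraphs `Hᵢ ∈ Eqs(𝓗)` whose
vertex sets are all contained in `V`. -/
def Supports {d : ℕ} (V : Finset ℕ) (H : HG d) (𝓗 : Set (HG d)) : Prop :=
  ∃ (l : ℕ) (c : Fin l → ℤ) (F : Fin l → HG d),
    (∀ i, F i ∈ Eqs 𝓗) ∧ (∀ i, verts (F i) ⊆ V) ∧ H = ∑ i, c i • F i

namespace SimpleHG

open Finset

/-- Transversal selected by `χ`. -/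
def cr {m : ℕ} (α β : Fin m → ℕ) (χ : Fin m → Bool) : Finset ℕ :=
  Finset.image (fun i => if χ i then β i else α i) Finset.univ

def sgn {m : ℕ} (χ : Fin m → Bool) : ℤ := ∏ i, (if χ i then (-1 : ℤ) else 1)

lemma sgn_eq {m : ℕ} (χ : Fin m → Bool) :
    sgn χ = (-1 : ℤ) ^ (Finset.univ.filter (fun i => χ i = true)).card := by
  simp [sgn, Finset.prod_ite]

/-- The elementary (cross-polytope) function. -/
def el {d m : ℕ} (α β : Fin m → ℕ) (a : Fin d → ℤ) : Finset ℕ → (Fin d → ℤ) :=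
  fun X => ∑ χ : Fin m → Bool, if X = cr α β χ then sgn χ • a else 0

structure Good {m : ℕ} (V : Finset ℕ) (α β : Fin m → ℕ) : Prop where
  ia : Function.Injective α
  ib : Function.Injective β
  ne : ∀ i j, α i ≠ β j
  ma : ∀ i, α i ∈ V
  mb : ∀ i, β i ∈ V

structure Ker {d : ℕ} (m : ℕ) (V : Finset ℕ) (f : Finset ℕ → (Fin d → ℤ)) : Prop where
  supp : ∀ X, f X ≠ 0 → X ⊆ V ∧ X.card = m
  ker : ∀ T : Finset ℕ, T.card < m → ∑ X ∈ V.powerset with T ⊆ X, f X = 0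

def Gen {d : ℕ} (m : ℕ) (V : Finset ℕ) (N : Submodule ℤ (Fin d → ℤ)) :
    Set (Finset ℕ → (Fin d → ℤ)) :=
  {f | ∃ (α β : Fin m → ℕ) (a : Fin d → ℤ), Good V α β ∧ a ∈ N ∧ f = el α β a}

lemma cr_subset {m : ℕ} {V : Finset ℕ} {α β : Fin m → ℕ} (h : Good V α β) (χ) :
    cr α β χ ⊆ V := by
  intro x hx
  simp only [cr, mem_image, mem_univ, true_and] at hx
  obtain ⟨i, rfl⟩ := hx
  split_ifs
  · exact h.mb i
  · exact h.ma i

lemma cr_card {m : ℕ} {V : Finset ℕ} {α β : Fin m → ℕ} (h : Good V α β) (χ) :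
    (cr α β χ).card = m := by
  rw [cr, Finset.card_image_of_injective, Finset.card_univ, Fintype.card_fin]
  intro i j hij
  have h1 := h.ne i j
  have h2 := h.ne j i
  dsimp only at hij
  split_ifs at hij
  · exact h.ib hij
  · exact absurd hij.symm h2
  · exact absurd hij h1
  · exact h.ia hij

lemma cr_inj {m : ℕ} {V : Finset ℕ} {α β : Fin m → ℕ} (h : Good V α β) :
    Function.Injective (cr α β) := by
  intro χ ψ hc
  funext i
  have key : ∀ χ : Fin m → Bool, β i ∈ cr α β χ ↔ χ i = true := by
    intro χ
    simp only [cr, mem_image, mem_univ, true_and]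
    constructor
    · rintro ⟨j, hj⟩
      split_ifs at hj with hb
      · rwa [h.ib hj] at hb
      · exact absurd hj (h.ne _ _)
    · intro hb
      exact ⟨i, by simp [hb]⟩
  have h1 := key χ
  rw [hc, key ψ] at h1
  cases hx : χ i <;> cases hy : ψ i <;> simp_all

lemma el_mem {d m : ℕ} (α β : Fin m → ℕ) (a : Fin d → ℤ) (N : Submodule ℤ (Fin d → ℤ))
    (ha : a ∈ N) (X) : el α β a X ∈ N := by
  refine N.sum_mem fun χ _ => ?_
  split_ifs
  · exact N.smul_mem _ ha
  · exact N.zero_mem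

lemma el_ker {d m : ℕ} {V : Finset ℕ} {α β : Fin m → ℕ} (h : Good V α β) (a : Fin d → ℤ) :
    Ker m V (el α β a) := by
  constructor
  · intro X hX
    obtain ⟨χ, _, hχ⟩ := Finset.exists_ne_zero_of_sum_ne_zero hX
    have : X = cr α β χ := by
      by_contra hn
      simp [hn] at hχ
    rw [this]
    exact ⟨cr_subset h χ, cr_card h χ⟩
  · intro T hT
    obtain ⟨i, hia, hib⟩ : ∃ i, α i ∉ T ∧ β i ∉ T := by
      by_contra! hcon
      have : m ≤ T.card := by
        have := Finset.card_le_card_of_injOn (s := (Finset.univ : Finset (Fin m))) (t := T)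
          (fun i => if α i ∈ T then α i else β i)
          (by
            intro i _
            dsimp only
            split_ifs with hh
            · exact hh
            · exact hcon i hh)
          (by
            intro i _ j _ hij
            have h1 := h.ne i j
            have h2 := h.ne j i
            dsimp only at hij
            split_ifs at hij
            · exact h.ia hij
            · exact absurd hij h1
            · exact absurd hij.symm h2
            · exact h.ib hij)
        simpa using this
      omega
    unfold el
    rw [Finset.sum_comm]
    have step : ∀ χ : Fin m → Bool,
        (∑ X ∈ V.powerset with T ⊆ X, if X = cr α β χ then sgn χ • a else 0)
          = if T ⊆ cr α β χ then sgn χ • a else 0 := by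
      intro χ
      rw [Finset.sum_ite_eq']
      simp [cr_subset h χ]
    rw [Finset.sum_congr rfl fun χ _ => step χ]
    have hsub : ∀ χ : Fin m → Bool, T ⊆ cr α β χ → T ⊆ cr α β (Function.update χ i (!χ i)) := by
      intro χ hs t ht
      have := hs ht
      simp only [cr, mem_image, mem_univ, true_and] at this ⊢
      obtain ⟨j, hj⟩ := this
      have hji : j ≠ i := by
        rintro rfl
        split_ifs at hj
        · exact hib (hj ▸ ht)
        · exact hia (hj ▸ ht)
      exact ⟨j, by rw [Function.update_of_ne hji]; exact hj⟩
    have hinv : ∀ χ : Fin m → Bool,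
        Function.update (Function.update χ i (!χ i)) i
          (!(Function.update χ i (!χ i)) i) = χ := by
      intro χ
      simp
    refine Finset.sum_involution (fun χ _ => Function.update χ i (!χ i)) ?_ ?_ ?_ ?_
    · intro χ _
      have hiff : T ⊆ cr α β (Function.update χ i (!χ i)) ↔ T ⊆ cr α β χ := by
        constructor
        · intro hh
          have := hsub _ hh
          rwa [hinv] at this
        · exact hsub χ
      have hs : sgn (Function.update χ i (!χ i)) = - sgn χ := by
        unfold sgn
        rw [← Finset.mul_prod_erase univ _ (mem_univ i),
          ← Finset.mul_prod_erase univ (fun j => if χ j then (-1 : ℤ) else 1) (mem_univ i)]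
        have : ∏ x ∈ univ.erase i, (if (Function.update χ i (!χ i)) x then (-1 : ℤ) else 1)
            = ∏ x ∈ univ.erase i, (if χ x then (-1 : ℤ) else 1) := by
          refine Finset.prod_congr rfl fun x hx => ?_
          rw [Function.update_of_ne (Finset.ne_of_mem_erase hx)]
        rw [this]
        cases hc : χ i <;> simp
      simp only [hiff, hs]
      split_ifs <;> simp
    · intro χ _ _ heq
      have := congrFun heq i
      simp at this
    · intro χ _
      exact mem_univ _
    · intro χ _
      exact hinv χ

lemma Ker.zero {d m : ℕ} {V : Finset ℕ} : Ker m V (0 : Finset ℕ → (Fin d → ℤ)) :=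
  ⟨fun X h => absurd rfl h, fun T _ => by simp⟩

lemma Ker.add {d m : ℕ} {V : Finset ℕ} {f g : Finset ℕ → (Fin d → ℤ)}
    (hf : Ker m V f) (hg : Ker m V g) : Ker m V (f + g) := by
  constructor
  · intro X h
    by_cases h1 : f X = 0
    · refine hg.supp X fun h2 => h ?_
      simp [h1, h2]
    · exact hf.supp X h1
  · intro T hT
    simp only [Pi.add_apply, Finset.sum_add_distrib, hf.ker T hT, hg.ker T hT, add_zero]

lemma Ker.smul {d m : ℕ} {V : Finset ℕ} {f : Finset ℕ → (Fin d → ℤ)} (c : ℤ)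
    (hf : Ker m V f) : Ker m V (c • f) := by
  constructor
  · intro X h
    refine hf.supp X fun h2 => h ?_
    simp [h2]
  · intro T hT
    simp only [Pi.smul_apply, ← Finset.smul_sum, hf.ker T hT, smul_zero]

lemma span_ker {d m : ℕ} {V : Finset ℕ} {N : Submodule ℤ (Fin d → ℤ)}
    {f : Finset ℕ → (Fin d → ℤ)} (hf : f ∈ Submodule.span ℤ (Gen m V N)) :
    Ker m V f ∧ ∀ X, f X ∈ N := by
  induction hf using Submodule.span_induction with
  | mem x hx =>
    obtain ⟨α, β, a, hg, ha, rfl⟩ := hx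
    exact ⟨el_ker hg a, el_mem α β a N ha⟩
  | zero => exact ⟨Ker.zero, fun X => N.zero_mem⟩
  | add x y _ _ hx hy => exact ⟨hx.1.add hy.1, fun X => N.add_mem (hx.2 X) (hy.2 X)⟩
  | smul c x _ hx => exact ⟨hx.1.smul c, fun X => N.smul_mem c (hx.2 X)⟩

lemma Gen_mono {d m : ℕ} {V W : Finset ℕ} {N : Submodule ℤ (Fin d → ℤ)} (h : V ⊆ W) :
    Gen m V N ⊆ Gen m W N := by
  rintro f ⟨α, β, a, hg, ha, rfl⟩
  exact ⟨α, β, a, ⟨hg.ia, hg.ib, hg.ne, fun i => h (hg.ma i), fun i => h (hg.mb i)⟩, ha, rfl⟩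

lemma inj_lemma {d m : ℕ} {V : Finset ℕ} {f : Finset ℕ → (Fin d → ℤ)}
    (hf : Ker m V f) (hV : V.card < 2 * m) : f = 0 := by
  funext Z
  by_contra hZ
  obtain ⟨hZV, hZm⟩ := hf.supp Z hZ
  have e1 : ∑ T ∈ Z.powerset, (-1 : ℤ) ^ T.card • ∑ X ∈ V.powerset with T ⊆ X, f X
      = (-1 : ℤ) ^ m • f Z := by
    rw [Finset.sum_eq_single Z]
    · rw [hZm]
      congr 1
      rw [Finset.sum_eq_single Z]
      · intro X hX hne
        by_contra h0
        have h1 := (hf.supp X h0).2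
        have h2 := (mem_filter.mp hX).2
        exact hne (Finset.eq_of_subset_of_card_le h2 (by omega)).symm
      · intro hn
        simp [hZV] at hn
    · intro T hT hne
      have : T.card < m := by
        rw [← hZm]
        exact Finset.card_lt_card ((mem_powerset.mp hT).ssubset_of_ne hne)
      rw [hf.ker T this, smul_zero]
    · simp
  have e2 : ∑ T ∈ Z.powerset, (-1 : ℤ) ^ T.card • ∑ X ∈ V.powerset with T ⊆ X, f X = 0 := by
    simp only [Finset.sum_filter, Finset.smul_sum]
    rw [Finset.sum_comm]
    refine Finset.sum_eq_zero fun X hX => ?_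
    have : ∑ T ∈ Z.powerset, (-1 : ℤ) ^ T.card • (if T ⊆ X then f X else 0)
        = (∑ T ∈ (Z ∩ X).powerset, (-1 : ℤ) ^ T.card) • f X := by
      rw [Finset.sum_smul]
      have hp : (Z ∩ X).powerset = Z.powerset.filter (fun T => T ⊆ X) := by
        ext T
        rw [mem_powerset, mem_filter, mem_powerset, Finset.subset_inter_iff]
      rw [hp, Finset.sum_filter]
      refine Finset.sum_congr rfl fun T _ => ?_
      split_ifs <;> simp
    rw [this, Finset.sum_powerset_neg_one_pow_card]
    split_ifs with he
    · rw [one_smul]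
      by_contra h0
      obtain ⟨h1, h2⟩ := hf.supp X h0
      have h3 : (Z ∪ X).card = Z.card + X.card :=
        Finset.card_union_of_disjoint (Finset.disjoint_iff_inter_eq_empty.mpr he)
      have h4 := Finset.card_le_card (Finset.union_subset hZV h1)
      omega
    · simp
  rw [e2] at e1
  have := smul_eq_zero.mp e1.symm
  rcases this with h | h
  · exact absurd h (by simp)
  · exact hZ h

lemma cr_cons {m : ℕ} (v u : ℕ) (α β : Fin m → ℕ) (b : Bool) (χ : Fin m → Bool) :
    cr (Fin.cons v α : Fin (m+1) → ℕ) (Fin.cons u β : Fin (m+1) → ℕ)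
      (Fin.cons b χ : Fin (m+1) → Bool) = insert (if b then u else v) (cr α β χ) := by
  ext x
  simp only [cr, mem_image, mem_univ, true_and, mem_insert, Fin.exists_fin_succ, Fin.cons_zero,
    Fin.cons_succ]
  rw [eq_comm]

lemma sgn_cons {m : ℕ} (b : Bool) (χ : Fin m → Bool) :
    sgn (Fin.cons b χ : Fin (m+1) → Bool) = (if b then (-1) else 1) * sgn χ := by
  simp [sgn, Fin.prod_univ_succ]

lemma el_cons {d m : ℕ} {V : Finset ℕ} {α β : Fin m → ℕ} (h : Good V α β) {v u : ℕ}
    (hv : v ∉ V) (hvu : v ≠ u) (a : Fin d → ℤ) {Y : Finset ℕ} (hY : v ∉ Y) :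
    el (Fin.cons v α : Fin (m+1) → ℕ) (Fin.cons u β : Fin (m+1) → ℕ) a (insert v Y)
      = el α β a Y := by
  unfold el
  rw [← (Fin.consEquiv (fun _ : Fin (m+1) => Bool)).sum_comp, Fintype.sum_prod_type,
    Fintype.sum_bool]
  have hcr : ∀ χ, v ∉ cr α β χ := fun χ hh => hv (cr_subset h χ hh)
  have h1 : ∀ χ : Fin m → Bool, insert v Y ≠ insert u (cr α β χ) := by
    intro χ he
    have : v ∈ insert u (cr α β χ) := he ▸ mem_insert_self v Y
    rcases mem_insert.mp this with h' | h'
    · exact hvu h'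
    · exact hcr χ h'
  have h2 : ∀ χ : Fin m → Bool, insert v Y = insert v (cr α β χ) ↔ Y = cr α β χ := by
    intro χ
    constructor
    · intro he
      have := congrArg (fun s => Finset.erase s v) he
      simpa [Finset.erase_insert hY, Finset.erase_insert (hcr χ)] using this
    · rintro rfl
      rfl
  have e1 : ∑ χ : Fin m → Bool, (if insert v Y = cr (Fin.cons v α : Fin (m+1) → ℕ)
      (Fin.cons u β : Fin (m+1) → ℕ) (Fin.consEquiv (fun _ : Fin (m+1) => Bool) (true, χ))
      then sgn (Fin.consEquiv (fun _ : Fin (m+1) => Bool) (true, χ)) • a else 0) = 0 := by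
    refine Finset.sum_eq_zero fun χ _ => ?_
    rw [if_neg]
    change ¬ (insert v Y = cr (Fin.cons v α : Fin (m+1) → ℕ)
      (Fin.cons u β : Fin (m+1) → ℕ) (Fin.cons true χ : Fin (m+1) → Bool))
    rw [cr_cons]
    simpa using h1 χ
  rw [e1, zero_add]
  refine Finset.sum_congr rfl fun χ _ => ?_
  change (if insert v Y = cr (Fin.cons v α : Fin (m+1) → ℕ)
      (Fin.cons u β : Fin (m+1) → ℕ) (Fin.cons false χ : Fin (m+1) → Bool)
      then sgn (Fin.cons false χ : Fin (m+1) → Bool) • a else 0) = _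
  rw [cr_cons, sgn_cons]
  simp [h2 χ]

lemma Good.cons {m : ℕ} {V W : Finset ℕ} {α β : Fin m → ℕ} (h : Good V α β) {v u : ℕ}
    (hVW : V ⊆ W) (hv : v ∉ V) (hvW : v ∈ W) (hu : u ∈ V)
    (hua : ∀ i, α i ≠ u) (hub : ∀ i, β i ≠ u) :
    Good W (Fin.cons v α : Fin (m+1) → ℕ) (Fin.cons u β : Fin (m+1) → ℕ) := by
  have hva : ∀ i, α i ≠ v := fun i e => hv (e ▸ h.ma i)
  have hvb : ∀ i, β i ≠ v := fun i e => hv (e ▸ h.mb i)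
  constructor
  · rw [Fin.cons_injective_iff]
    exact ⟨by rintro ⟨i, hi⟩; exact hva i hi, h.ia⟩
  · rw [Fin.cons_injective_iff]
    exact ⟨by rintro ⟨i, hi⟩; exact hub i hi, h.ib⟩
  · intro i j
    refine Fin.cases ?_ (fun i => ?_) i <;> refine Fin.cases ?_ (fun j => ?_) j
    · simp only [Fin.cons_zero]
      rintro rfl
      exact hv hu
    · simpa using (hvb j).symm
    · simpa using hua i
    · simpa using h.ne i j
  · intro i
    refine Fin.cases ?_ (fun i => ?_) i
    · simpa using hvW
    · simpa using hVW (h.ma i)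
  · intro i
    refine Fin.cases ?_ (fun i => ?_) i
    · simpa using hVW hu
    · simpa using hVW (h.mb i)

lemma push {d m : ℕ} {V : Finset ℕ} {N : Submodule ℤ (Fin d → ℤ)} {v : ℕ} (hv : v ∈ V)
    (hc : 2 * m < (V.erase v).card) {g : Finset ℕ → (Fin d → ℤ)}
    (hg : g ∈ Submodule.span ℤ (Gen m (V.erase v) N)) :
    ∃ f ∈ Submodule.span ℤ (Gen (m+1) V N), ∀ Y, v ∉ Y → f (insert v Y) = g Y := by
  induction hg using Submodule.span_induction with
  | mem x hx =>
    obtain ⟨α, β, a, hg, ha, rfl⟩ := hx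
    obtain ⟨u, hu, hu2⟩ : ∃ u ∈ V.erase v, u ∉ univ.image α ∪ univ.image β := by
      apply Finset.exists_mem_notMem_of_card_lt_card
      refine lt_of_le_of_lt (Finset.card_union_le _ _) (lt_of_le_of_lt ?_ hc)
      have h1 := Finset.card_image_le (s := (univ : Finset (Fin m))) (f := α)
      have h2 := Finset.card_image_le (s := (univ : Finset (Fin m))) (f := β)
      simp only [Finset.card_univ, Fintype.card_fin] at h1 h2
      omega
    simp only [mem_union, mem_image, mem_univ, true_and, not_or, not_exists] at hu2
    refine ⟨_, Submodule.subset_span ⟨_, _, a,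
      hg.cons (W := V) (Finset.erase_subset _ _) (Finset.notMem_erase v V) hv hu hu2.1 hu2.2,
        ha, rfl⟩, ?_⟩
    intro Y hY
    exact el_cons hg (Finset.notMem_erase v V) (Finset.ne_of_mem_erase hu).symm a hY
  | zero => exact ⟨0, Submodule.zero_mem _, fun Y _ => rfl⟩
  | add x y _ _ hx hy =>
    obtain ⟨f, hf, hf'⟩ := hx
    obtain ⟨f2, hf2, hf2'⟩ := hy
    exact ⟨f + f2, Submodule.add_mem _ hf hf2, fun Y hY => by
      simp [hf' Y hY, hf2' Y hY]⟩
  | smul c x _ hx =>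
    obtain ⟨f, hf, hf'⟩ := hx
    exact ⟨c • f, Submodule.smul_mem _ c hf, fun Y hY => by simp [hf' Y hY]⟩

lemma link {d m : ℕ} {V : Finset ℕ} {f : Finset ℕ → (Fin d → ℤ)} {v : ℕ} (hv : v ∈ V)
    (hf : Ker (m+1) V f) :
    Ker m (V.erase v) (fun Y => if v ∈ Y then 0 else f (insert v Y)) := by
  constructor
  · intro Y hY
    by_cases hvY : v ∈ Y
    · simp [hvY] at hY
    · simp only [hvY, if_false] at hY
      obtain ⟨h1, h2⟩ := hf.supp _ hY
      rw [Finset.card_insert_of_notMem hvY] at h2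
      refine ⟨fun y hy => mem_erase.mpr ⟨?_, h1 (mem_insert_of_mem hy)⟩, by omega⟩
      rintro rfl
      exact hvY hy
  · intro T hT
    by_cases hvT : v ∈ T
    · refine Finset.sum_eq_zero fun Y hY => ?_
      rw [if_pos ((mem_filter.mp hY).2 hvT)]
    · have hk := hf.ker (insert v T) (by rw [Finset.card_insert_of_notMem hvT]; omega)
      rw [← hk]
      refine Finset.sum_bij' (fun Y _ => insert v Y) (fun X _ => X.erase v) ?_ ?_ ?_ ?_ ?_
      · intro Y hY
        simp only [mem_filter, mem_powerset] at hY ⊢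
        exact ⟨Finset.insert_subset hv (hY.1.trans (Finset.erase_subset _ _)),
          Finset.insert_subset_insert v hY.2⟩
      · intro X hX
        simp only [mem_filter, mem_powerset] at hX ⊢
        refine ⟨Finset.erase_subset_erase v hX.1, fun t ht => mem_erase.mpr ⟨?_, hX.2 (mem_insert_of_mem ht)⟩⟩
        rintro rfl
        exact hvT ht
      · intro Y hY
        simp only [mem_filter, mem_powerset] at hY
        exact Finset.erase_insert fun h => Finset.notMem_erase v V (hY.1 h)
      · intro X hX
        simp only [mem_filter, mem_powerset] at hX
        exact Finset.insert_erase (hX.2 (mem_insert_self _ _))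
      · intro Y hY
        simp only [mem_filter, mem_powerset] at hY
        rw [if_neg fun h => Finset.notMem_erase v V (hY.1 h)]

lemma ker_erase {d m : ℕ} {V : Finset ℕ} {f : Finset ℕ → (Fin d → ℤ)} {v : ℕ}
    (hf : Ker m V f) (h0 : ∀ X, v ∈ X → f X = 0) : Ker m (V.erase v) f := by
  constructor
  · intro X hX
    obtain ⟨h1, h2⟩ := hf.supp X hX
    refine ⟨fun y hy => mem_erase.mpr ⟨?_, h1 hy⟩, h2⟩
    rintro rfl
    exact hX (h0 X hy)
  · intro T hT
    rw [← hf.ker T hT]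
    refine Finset.sum_subset ?_ ?_
    · intro X hX
      simp only [mem_filter, mem_powerset] at hX ⊢
      exact ⟨hX.1.trans (Finset.erase_subset _ _), hX.2⟩
    · intro X hX hX2
      simp only [mem_filter, mem_powerset] at hX hX2
      apply h0
      by_contra hvX
      refine hX2 ⟨fun y hy => mem_erase.mpr ⟨?_, hX.1 hy⟩, hX.2⟩
      rintro rfl
      exact hvX hy

lemma main_comb {d : ℕ} (N : Submodule ℤ (Fin d → ℤ)) :
    ∀ (n : ℕ) (V : Finset ℕ), V.card = n → ∀ (m : ℕ) (f : Finset ℕ → (Fin d → ℤ)),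
      Ker m V f → (∀ X, f X ∈ N) → 2 * m ≤ n → f ∈ Submodule.span ℤ (Gen m V N) := by
  intro n
  induction n with
  | zero =>
    intro V hV m f hf hN hm
    obtain rfl : m = 0 := by omega
    refine Submodule.subset_span ⟨Fin.elim0, Fin.elim0, f ∅,
      ⟨fun i => i.elim0, fun i => i.elim0, fun i => i.elim0, fun i => i.elim0,
        fun i => i.elim0⟩, hN ∅, ?_⟩
    funext X
    by_cases hX : X = ∅
    · subst hX; simp [el, cr, sgn]
    · have : f X = 0 := by
        by_contra h
        exact hX (Finset.card_eq_zero.mp (hf.supp X h).2)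
      simp [el, cr, hX, this]
  | succ n ih =>
    intro V hV m f hf hN hm
    cases m with
    | zero =>
      refine Submodule.subset_span ⟨Fin.elim0, Fin.elim0, f ∅,
        ⟨fun i => i.elim0, fun i => i.elim0, fun i => i.elim0, fun i => i.elim0,
          fun i => i.elim0⟩, hN ∅, ?_⟩
      funext X
      by_cases hX : X = ∅
      · subst hX; simp [el, cr, sgn]
      · have : f X = 0 := by
          by_contra h
          exact hX (Finset.card_eq_zero.mp (hf.supp X h).2)
        simp [el, cr, hX, this]
    | succ m =>
      obtain ⟨v, hv⟩ : V.Nonempty := Finset.card_pos.mp (by omega)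
      have hc : (V.erase v).card = n := by rw [Finset.card_erase_of_mem hv]; omega
      have hg := ih (V.erase v) hc m _ (link hv hf)
        (fun Y => by split_ifs; exacts [N.zero_mem, hN _]) (by omega)
      obtain ⟨f', hf', hfe⟩ := push hv (by omega) hg
      obtain ⟨hk', hN'⟩ := span_ker hf'
      have hhk : Ker (m+1) V (f - f') := by
        have := hf.add (hk'.smul (-1))
        rwa [neg_one_smul, ← sub_eq_add_neg] at this
      have hh := ker_erase (v := v) hhk (fun X hX => by
        have := hfe (X.erase v) (Finset.notMem_erase _ _)
        rw [Finset.insert_erase hX, if_neg (Finset.notMem_erase _ _)] at this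
        simp [this])
      have hmem : f - f' ∈ Submodule.span ℤ (Gen (m+1) V N) := by
        by_cases hle : 2 * (m + 1) ≤ n
        · exact Submodule.span_mono (Gen_mono (Finset.erase_subset v V))
            (ih (V.erase v) hc (m+1) _ hh (fun X => N.sub_mem (hN X) (hN' X)) hle)
        · rw [inj_lemma hh (by omega)]
          exact Submodule.zero_mem _
      have := Submodule.add_mem _ hmem hf'
      simpa using this

/-! Hypergraph level -/

lemma subset_verts {d : ℕ} {G : HG d} {e : Finset ℕ} (he : G e ≠ 0) : e ⊆ verts G :=
  Finset.le_sup (f := id) (Finsupp.mem_support_iff.mpr he)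

lemma verts_subset_iff {d : ℕ} {G : HG d} {V : Finset ℕ} :
    verts G ⊆ V ↔ ∀ e, G e ≠ 0 → e ⊆ V := by
  constructor
  · intro h e he
    exact (subset_verts he).trans h
  · intro h
    exact Finset.sup_le fun e he => h e (Finsupp.mem_support_iff.mp he)

lemma weight_eq {d : ℕ} {G : HG d} {V : Finset ℕ} (h : verts G ⊆ V) (X : Finset ℕ) :
    weight X G = ∑ e ∈ V.powerset with X ⊆ e, G e := by
  refine Finset.sum_subset ?_ ?_
  · intro e he
    simp only [mem_filter, mem_powerset, Finsupp.mem_support_iff] at he ⊢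
    exact ⟨verts_subset_iff.mp h e he.1, he.2⟩
  · intro e he hn
    simp only [mem_filter, Finsupp.mem_support_iff] at he hn
    by_contra h0
    exact hn ⟨h0, he.2⟩

lemma weight_zero_of {d : ℕ} {G : HG d} {X : Finset ℕ} (h : ¬ X ⊆ verts G) :
    weight X G = 0 := by
  refine Finset.sum_eq_zero fun e he => ?_
  simp only [mem_filter, Finsupp.mem_support_iff] at he
  exact absurd (he.2.trans (subset_verts he.1)) h

/-- Working predicate for hypergraphs. -/
def Sub (d k : ℕ) (V : Finset ℕ) : Submodule ℤ (HG d) where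
  carrier := {G | ∀ e, G e ≠ 0 → e ⊆ V ∧ e.card = k}
  zero_mem' := fun e he => absurd rfl he
  add_mem' := by
    intro f g hf hg e he
    by_cases h1 : f e = 0
    · exact hg e fun h2 => he (by simp [h1, h2])
    · exact hf e h1
  smul_mem' := by
    intro c f hf e he
    exact hf e fun h2 => he (by simp [h2])

lemma mem_Sub {d k : ℕ} {V : Finset ℕ} {G : HG d} :
    G ∈ Sub d k V ↔ verts G ⊆ V ∧ IsHG k G := by
  rw [verts_subset_iff]
  constructor
  · intro h
    exact ⟨fun e he => (h e he).1, fun e he => (h e (Finsupp.mem_support_iff.mp he)).2⟩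
  · intro h e he
    exact ⟨h.1 e he, h.2 e (Finsupp.mem_support_iff.mpr he)⟩

lemma weight_zero {d : ℕ} (X : Finset ℕ) : weight X (0 : HG d) = 0 := by
  simp [weight]

lemma weight_add {d k : ℕ} {V : Finset ℕ} {F G : HG d} (hF : F ∈ Sub d k V)
    (hG : G ∈ Sub d k V) (X : Finset ℕ) : weight X (F + G) = weight X F + weight X G := by
  rw [weight_eq (mem_Sub.mp hF).1, weight_eq (mem_Sub.mp hG).1,
    weight_eq (mem_Sub.mp (Submodule.add_mem _ hF hG)).1, ← Finset.sum_add_distrib]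
  rfl

lemma weight_smul {d k : ℕ} {V : Finset ℕ} {F : HG d} (hF : F ∈ Sub d k V)
    (c : ℤ) (X : Finset ℕ) : weight X (c • F) = c • weight X F := by
  rw [weight_eq (mem_Sub.mp hF).1,
    weight_eq (mem_Sub.mp (Submodule.smul_mem _ c hF)).1, Finset.smul_sum]
  rfl

lemma count {e T : Finset ℕ} (m : ℕ) (hT : T ⊆ e) (hm : T.card ≤ m) :
    ((e.powersetCard m).filter (fun X => T ⊆ X)).card
      = (e.card - T.card).choose (m - T.card) := by
  rw [← Finset.card_sdiff_of_subset hT, ← Finset.card_powersetCard]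
  refine Finset.card_bij' (fun X _ => X \ T) (fun Y _ => Y ∪ T) ?_ ?_ ?_ ?_
  · intro X hX
    simp only [mem_filter, mem_powersetCard] at hX ⊢
    exact ⟨Finset.sdiff_subset_sdiff hX.1.1 le_rfl, by
      rw [Finset.card_sdiff_of_subset hX.2, hX.1.2]⟩
  · intro Y hY
    simp only [mem_filter, mem_powersetCard] at hY ⊢
    refine ⟨⟨Finset.union_subset (hY.1.trans Finset.sdiff_subset) hT, ?_⟩,
      Finset.subset_union_right⟩
    rw [Finset.card_union_of_disjoint (Finset.disjoint_of_subset_left hY.1 Finset.sdiff_disjoint)]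
    omega
  · intro X hX
    simp only [mem_filter] at hX
    exact Finset.sdiff_union_of_subset hX.2
  · intro Y hY
    simp only [mem_powersetCard] at hY
    exact Finset.union_sdiff_cancel_right
      (Finset.disjoint_of_subset_left hY.1 Finset.sdiff_disjoint)

lemma ker_weight {d k m : ℕ} {V : Finset ℕ} {G : HG d} (hG : G ∈ Sub d k V)
    (h0 : ∀ T : Finset ℕ, T.card < m → weight T G = 0) :
    Ker m V (fun X => if X.card = m then weight X G else 0) := by
  constructor
  · intro X hX
    by_cases hc : X.card = m
    · refine ⟨?_, hc⟩
      simp only [hc, if_true] at hX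
      by_contra hn
      exact hX (weight_zero_of fun h => hn (h.trans (mem_Sub.mp hG).1))
    · simp [hc] at hX
  · intro T hT
    have key : ∑ X ∈ V.powerset with T ⊆ X, (if X.card = m then weight X G else 0)
        = ((k - T.card).choose (m - T.card)) • weight T G := by
      have e1 : ∀ X, (if X.card = m then weight X G else 0)
          = ∑ e ∈ V.powerset, if X.card = m ∧ X ⊆ e then G e else 0 := by
        intro X
        rw [weight_eq (mem_Sub.mp hG).1, Finset.sum_filter]
        split_ifs with h <;> simp [h]
      rw [Finset.sum_congr rfl fun X _ => e1 X, Finset.sum_comm,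
        weight_eq (mem_Sub.mp hG).1, Finset.sum_filter, Finset.smul_sum]
      refine Finset.sum_congr rfl fun e he => ?_
      by_cases hz : G e = 0
      · simp [hz]
      obtain ⟨heV, hek⟩ := hG e hz
      rw [← Finset.sum_filter, Finset.filter_filter, Finset.sum_const]
      split_ifs with hTe
      · congr 1
        rw [← hek, ← count m hTe hT.le]
        congr 1
        ext X
        simp only [mem_filter, mem_powerset, mem_powersetCard]
        constructor
        · rintro ⟨_, h1, h2, h3⟩
          exact ⟨⟨h3, h2⟩, h1⟩
        · rintro ⟨⟨h3, h2⟩, h1⟩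
          exact ⟨h3.trans heV, h1, h2, h3⟩
      · rw [Finset.filter_eq_empty_iff.mpr, Finset.card_empty, zero_smul, smul_zero]
        rintro X _ ⟨h1, _, h3⟩
        exact hTe (h1.trans h3)
    rw [key, h0 T hT, smul_zero]

lemma exists_perm {ι : Type} [Finite ι] (p q : ι → ℕ) (hp : Function.Injective p)
    (hq : Function.Injective q) : ∃ π : ℕ ≃ ℕ, ∀ i, π (p i) = q i := by
  classical
  have fp : (Set.range p)ᶜ.Infinite := (Set.finite_range p).infinite_compl
  have fq : (Set.range q)ᶜ.Infinite := (Set.finite_range q).infinite_compl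
  have := fp.to_subtype
  have := fq.to_subtype
  obtain ⟨e2⟩ := nonempty_equiv_of_countable (α := ↥(Set.range p)ᶜ) (β := ↥(Set.range q)ᶜ)
  let e1 : {x // x ∈ Set.range p} ≃ {x // x ∈ Set.range q} :=
    (Equiv.ofInjective p hp).symm.trans (Equiv.ofInjective q hq)
  let e2' : {x // ¬ x ∈ Set.range p} ≃ {x // ¬ x ∈ Set.range q} := e2
  refine ⟨Equiv.subtypeCongr e1 e2', fun i => ?_⟩
  have hx : p i ∈ Set.range p := ⟨i, rfl⟩
  have h1 : (Equiv.ofInjective p hp).symm ⟨p i, hx⟩ = i :=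
    Equiv.ofInjective_symm_apply hp i
  simp only [Equiv.subtypeCongr, Equiv.trans_apply, Equiv.sumCompl_symm_apply_of_pos hx,
    Equiv.sumCongr_apply, Sum.map_inl, Equiv.sumCompl_apply_inl, e1, h1,
    Equiv.ofInjective_apply]

/-- Relabelling of a hypergraph. -/
noncomputable def rel {d : ℕ} (π : ℕ ≃ ℕ) (G : HG d) : HG d :=
  Finsupp.equivMapDomain π.finsetCongr G

lemma finsetCongr_eq (π : ℕ ≃ ℕ) (e : Finset ℕ) : π.finsetCongr e = e.image π := by
  ext x
  simp only [Equiv.finsetCongr, Equiv.coe_fn_mk, Finset.mem_map_equiv, mem_image]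
  constructor
  · intro h
    exact ⟨π.symm x, h, by simp⟩
  · rintro ⟨a, ha, rfl⟩
    simpa using ha

lemma rel_apply {d : ℕ} (π : ℕ ≃ ℕ) (G : HG d) (e : Finset ℕ) :
    rel π G (e.image π) = G e := by
  rw [rel, Finsupp.equivMapDomain_apply, ← finsetCongr_eq, Equiv.symm_apply_apply]

lemma equiv_weight {d : ℕ} {π : ℕ ≃ ℕ} {G F : HG d} (h : ∀ e : Finset ℕ, F (e.image π) = G e)
    (X : Finset ℕ) : weight (X.image π) F = weight X G := by
  unfold weight
  symm
  refine Finset.sum_bij (fun e _ => e.image π) ?_ ?_ ?_ ?_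
  · intro e he
    simp only [mem_filter, Finsupp.mem_support_iff] at he ⊢
    exact ⟨by rw [h]; exact he.1, Finset.image_subset_image he.2⟩
  · intro e _ e' _ hee
    exact Finset.image_injective π.injective hee
  · intro e he
    simp only [mem_filter, Finsupp.mem_support_iff] at he
    have hee : (e.image π.symm).image π = e := by
      rw [Finset.image_image]
      simp
    refine ⟨e.image π.symm, ?_, hee⟩
    simp only [mem_filter, Finsupp.mem_support_iff]
    refine ⟨by rw [← h, hee]; exact he.1, ?_⟩
    have := Finset.image_subset_image (f := π.symm) he.2
    rw [Finset.image_image] at this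
    simpa using this
  · intro e _
    exact (h e).symm

lemma image_symm_image (π : ℕ ≃ ℕ) (X : Finset ℕ) : (X.image π.symm).image π = X := by
  rw [Finset.image_image]
  simp

/-- span of `m`-weights of `S` -/
def NN {d : ℕ} (S : Set (HG d)) (m : ℕ) : Submodule ℤ (Fin d → ℤ) :=
  Submodule.span ℤ {w : Fin d → ℤ | ∃ G ∈ S, ∃ X : Finset ℕ,
        X ⊆ verts G ∧ X.card = m ∧ w = weight X G}

lemma weight_mem_NN {d : ℕ} {S : Set (HG d)} {G : HG d} (hG : G ∈ S) (X : Finset ℕ) :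
    weight X G ∈ NN S X.card := by
  by_cases h : X ⊆ verts G
  · exact Submodule.subset_span ⟨G, hG, X, h, rfl, rfl⟩
  · rw [weight_zero_of h]
    exact Submodule.zero_mem _

lemma simple_good {m : ℕ} {A B C : Finset ℕ} {α β : Fin m → ℕ}
    (ia : Function.Injective α) (ib : Function.Injective β)
    (hA : A = Finset.image α Finset.univ) (hB : B = Finset.image β Finset.univ)
    (hAB : Disjoint A B) : Good (A ∪ B ∪ C) α β := by
  subst hA hB
  have ma : ∀ i, α i ∈ univ.image α := fun i => mem_image_of_mem _ (mem_univ i)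
  have mb : ∀ i, β i ∈ univ.image β := fun i => mem_image_of_mem _ (mem_univ i)
  exact ⟨ia, ib, fun i j => Finset.disjoint_iff_ne.mp hAB _ (ma i) _ (mb j),
    fun i => by simp, fun i => by simp⟩

lemma H_weight_mem {d k : ℕ} {S : Set (HG d)} {H : HG d} (hS : IsSimplificationOf k S {H})
    (X : Finset ℕ) (hX : X.card ≤ k) : weight X H ∈ NN S X.card := by
  obtain ⟨G, hG, A, B, C, α, β, ia, ib, hA, hB, hAB, hAC, hBC, hC, hv, hw, -, -⟩ :=
    hS X.card hX (weight X H) (weight_mem_NN (S := {H}) rfl X)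
  have hgood := simple_good (C := C) ia ib hA hB hAB
  have h1 := hw (fun _ => false)
  simp only [Bool.false_eq_true, Finset.filter_false, Finset.card_empty, pow_zero,
    one_smul] at h1
  have h2 := cr_card hgood (fun _ => false)
  have h3 := weight_mem_NN hG (cr α β fun _ => false)
  rw [h2] at h3
  rw [← h1]
  simpa [cr] using h3

lemma el_cr {d m : ℕ} {V : Finset ℕ} {α β : Fin m → ℕ} (h : Good V α β) (a : Fin d → ℤ)
    (χ : Fin m → Bool) : el α β a (cr α β χ) = sgn χ • a := by
  unfold el
  simp [(cr_inj h).eq_iff]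

lemma el_other {d m : ℕ} {α β : Fin m → ℕ} (a : Fin d → ℤ) (X : Finset ℕ)
    (h : ∀ χ, X ≠ cr α β χ) : el α β a X = 0 := by
  unfold el
  simp [h]

/-- generators available inside `V` -/
def Avail {d : ℕ} (S : Set (HG d)) (V : Finset ℕ) : Set (HG d) :=
  {F | F ∈ Eqs S ∧ verts F ⊆ V}

lemma equiv_isHG {d k : ℕ} {F G : HG d} (h : HGEquiv G F) (hG : IsHG k G) : IsHG k F := by
  obtain ⟨π, hπ⟩ := h
  intro e he
  have h1 := image_symm_image π e
  rw [Finsupp.mem_support_iff, ← h1, hπ] at he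
  have := hG _ (Finsupp.mem_support_iff.mpr he)
  rwa [Finset.card_image_of_injective _ π.symm.injective] at this

lemma avail_Sub {d k : ℕ} {S : Set (HG d)} (hSk : ∀ F ∈ S, IsHG k F) {V : Finset ℕ} {F : HG d}
    (hF : F ∈ Submodule.span ℤ (Avail S V)) : F ∈ Sub d k V := by
  revert F
  change Submodule.span ℤ (Avail S V) ≤ Sub d k V
  rw [Submodule.span_le]
  rintro F ⟨⟨G, hG, hE⟩, hv⟩
  exact mem_Sub.mpr ⟨hv, equiv_isHG hE (hSk G hG)⟩

lemma avail_weight {d k : ℕ} {S : Set (HG d)} (hSk : ∀ F ∈ S, IsHG k F) {V : Finset ℕ} {F : HG d}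
    (hF : F ∈ Submodule.span ℤ (Avail S V)) (X : Finset ℕ) : weight X F ∈ NN S X.card := by
  induction hF using Submodule.span_induction with
  | mem F hF =>
    obtain ⟨⟨G, hG, π, hπ⟩, hv⟩ := hF
    rw [← image_symm_image π X, equiv_weight hπ,
      Finset.card_image_of_injective _ π.injective]
    exact weight_mem_NN hG _
  | zero => rw [weight_zero]; exact Submodule.zero_mem _
  | add x y hx hy h1 h2 =>
    rw [weight_add (avail_Sub hSk hx) (avail_Sub hSk hy)]
    exact Submodule.add_mem _ h1 h2
  | smul c x hx h1 =>
    rw [weight_smul (avail_Sub hSk hx)]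
    exact Submodule.smul_mem _ c h1

lemma realize {d k m : ℕ} {S : Set (HG d)} {V : Finset ℕ} (hV : 2 * k ≤ V.card) (hm : m ≤ k)
    (hS : SelfSimplified k S) {α β : Fin m → ℕ} (hg : Good V α β) {a : Fin d → ℤ}
    (ha : a ∈ NN S m) :
    ∃ F ∈ Avail S V, (∀ X, X.card = m → weight X F = el α β a X) ∧
      ∀ T, T.card < m → weight T F = 0 := by
  obtain ⟨G, hG, A, B, C, α0, β0, ia, ib, hA, hB, hAB, hAC, hBC, hC, hv, hw, hw0, hwlt⟩ :=
    hS m hm a ha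
  have hgood := simple_good (C := C) ia ib hA hB hAB
  -- choose the target of `C`
  obtain ⟨C', hC'V, hC'c⟩ : ∃ C' ⊆ V \ (univ.image α ∪ univ.image β), C'.card = C.card := by
    apply Finset.exists_subset_card_eq
    have h1 := Finset.card_image_le (s := (univ : Finset (Fin m))) (f := α)
    have h2 := Finset.card_image_le (s := (univ : Finset (Fin m))) (f := β)
    simp only [Finset.card_univ, Fintype.card_fin] at h1 h2
    have h3 := Finset.card_union_le (univ.image α) (univ.image β)
    have h4 := Finset.le_card_sdiff (univ.image α ∪ univ.image β) V
    omega
  let eC : C ≃ C' := Finset.equivOfCardEq hC'c.symm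
  let p : Fin m ⊕ Fin m ⊕ C → ℕ := Sum.elim α0 (Sum.elim β0 (fun c => c.1))
  let q : Fin m ⊕ Fin m ⊕ C → ℕ := Sum.elim α (Sum.elim β (fun c => (eC c).1))
  have hCa : ∀ c i, α i ≠ (eC c).1 := by
    intro c i h
    have := (mem_sdiff.mp (hC'V (eC c).2)).2
    apply this
    rw [← h]
    simp
  have hCb : ∀ c i, β i ≠ (eC c).1 := by
    intro c i h
    have := (mem_sdiff.mp (hC'V (eC c).2)).2
    apply this
    rw [← h]
    simp
  have hp : Function.Injective p := by
    refine Function.Injective.sumElim ia (Function.Injective.sumElim ib Subtype.val_injective ?_) ?_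
    · intro i c
      exact Finset.disjoint_iff_ne.mp hBC _ (by simp [hB]) _ c.2
    · rintro i (j | c)
      · exact hgood.ne i j
      · exact Finset.disjoint_iff_ne.mp hAC _ (by simp [hA]) _ c.2
  have hq : Function.Injective q := by
    refine Function.Injective.sumElim hg.ia (Function.Injective.sumElim hg.ib
      (Subtype.val_injective.comp eC.injective) ?_) ?_
    · intro i c
      exact hCb c i
    · rintro i (j | c)
      · exact hg.ne i j
      · exact hCa c i
  obtain ⟨π, hπ⟩ := exists_perm p q hp hq
  have hπa : ∀ i, π (α0 i) = α i := fun i => hπ (Sum.inl i)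
  have hπb : ∀ i, π (β0 i) = β i := fun i => hπ (Sum.inr (Sum.inl i))
  have hπc : ∀ c : C, π c.1 = (eC c).1 := fun c => hπ (Sum.inr (Sum.inr c))
  have hABC : ∀ x ∈ A ∪ B ∪ C, π x ∈ V := by
    intro x hx
    rw [mem_union, mem_union] at hx
    rcases hx with (hx | hx) | hx
    · rw [hA] at hx
      obtain ⟨i, -, rfl⟩ := mem_image.mp hx
      rw [hπa]; exact hg.ma i
    · rw [hB] at hx
      obtain ⟨i, -, rfl⟩ := mem_image.mp hx
      rw [hπb]; exact hg.mb i
    · rw [hπc ⟨x, hx⟩]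
      exact (mem_sdiff.mp (hC'V (eC ⟨x, hx⟩).2)).1
  have hcr : ∀ χ, (cr α0 β0 χ).image π = cr α β χ := by
    intro χ
    unfold cr
    rw [Finset.image_image]
    congr 1
    funext i
    simp only [Function.comp]
    split_ifs
    · exact hπb i
    · exact hπa i
  refine ⟨rel π G, ⟨⟨G, hG, π, rel_apply π G⟩, ?_⟩, ?_, ?_⟩
  · rw [verts_subset_iff]
    intro e he
    rw [← image_symm_image π e, rel_apply] at he
    have h1 := (subset_verts he).trans hv
    intro x hx
    have := hABC _ (h1 (mem_image_of_mem π.symm hx))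
    simpa using this
  · intro X hX
    rw [← image_symm_image π X, equiv_weight (rel_apply π G)]
    set Y := X.image π.symm with hY
    have hYc : Y.card = m := by
      rw [hY, Finset.card_image_of_injective _ π.symm.injective, hX]
    by_cases hex : ∃ χ, Y = cr α0 β0 χ
    · obtain ⟨χ, hχ⟩ := hex
      rw [hχ, hcr, el_cr hg, sgn_eq]
      exact hw χ
    · push Not at hex
      rw [el_other]
      · by_cases hs : Y ⊆ A ∪ B ∪ C
        · exact hw0 Y hs hYc hex
        · exact weight_zero_of fun h => hs (h.trans hv)
      · intro χ hh
        rw [← hcr] at hh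
        exact hex χ (Finset.image_injective π.injective hh)
  · intro T hT
    rw [← image_symm_image π T, equiv_weight (rel_apply π G)]
    by_cases hs : T.image π.symm ⊆ A ∪ B ∪ C
    · exact hwlt _ hs (by rwa [Finset.card_image_of_injective _ π.symm.injective])
    · exact weight_zero_of fun h => hs (h.trans hv)

lemma realize_span {d k m : ℕ} {S : Set (HG d)} {V : Finset ℕ} (hV : 2 * k ≤ V.card) (hm : m ≤ k)
    (hSk : ∀ F ∈ S, IsHG k F) (hS : SelfSimplified k S) {f : Finset ℕ → (Fin d → ℤ)}
    (hf : f ∈ Submodule.span ℤ (Gen m V (NN S m))) :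
    ∃ F ∈ Submodule.span ℤ (Avail S V), (∀ X, X.card = m → weight X F = f X) ∧
      ∀ T, T.card < m → weight T F = 0 := by
  induction hf using Submodule.span_induction with
  | mem x hx =>
    obtain ⟨α, β, a, hg, ha, rfl⟩ := hx
    obtain ⟨F, hF, h1, h2⟩ := realize hV hm hS hg ha
    exact ⟨F, Submodule.subset_span hF, h1, h2⟩
  | zero => exact ⟨0, Submodule.zero_mem _, fun X _ => weight_zero X, fun X _ => weight_zero X⟩
  | add x y _ _ hx hy =>
    obtain ⟨F, hF, h1, h2⟩ := hx
    obtain ⟨F', hF', h1', h2'⟩ := hy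
    refine ⟨F + F', Submodule.add_mem _ hF hF', fun X hX => ?_, fun X hX => ?_⟩
    · rw [weight_add (avail_Sub hSk hF) (avail_Sub hSk hF'), h1 X hX, h1' X hX]; rfl
    · rw [weight_add (avail_Sub hSk hF) (avail_Sub hSk hF'), h2 X hX, h2' X hX, add_zero]
  | smul c x _ hx =>
    obtain ⟨F, hF, h1, h2⟩ := hx
    refine ⟨c • F, Submodule.smul_mem _ c hF, fun X hX => ?_, fun X hX => ?_⟩
    · rw [weight_smul (avail_Sub hSk hF), h1 X hX]; rfl
    · rw [weight_smul (avail_Sub hSk hF), h2 X hX, smul_zero]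

lemma levels {d k : ℕ} {S : Set (HG d)} {V : Finset ℕ} (hV : 2 * k ≤ V.card)
    (hSk : ∀ F ∈ S, IsHG k F) {H : HG d} (hS : SimpleFor k S {H}) (hH : H ∈ Sub d k V) :
    ∀ m, m ≤ k + 1 → ∃ F ∈ Submodule.span ℤ (Avail S V),
      ∀ T : Finset ℕ, T.card < m → weight T (H + F) = 0 := by
  intro m
  induction m with
  | zero => exact fun _ => ⟨0, Submodule.zero_mem _, fun T hT => absurd hT (by omega)⟩
  | succ m ih =>
    intro hm
    obtain ⟨F, hF, h0⟩ := ih (by omega)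
    have hFS := avail_Sub hSk hF
    have hHF := Submodule.add_mem _ hH hFS
    have hker := ker_weight hHF h0
    have hmem := main_comb (NN S m) V.card V rfl m _ hker (by
      intro X
      split_ifs with hX
      · subst hX
        rw [weight_add hH hFS]
        exact Submodule.add_mem _ (H_weight_mem hS.2 X (by omega)) (avail_weight hSk hF X)
      · exact Submodule.zero_mem _) (by omega)
    obtain ⟨F', hF', h1, h2⟩ := realize_span hV (by omega) hSk hS.1 hmem
    refine ⟨F + (-1 : ℤ) • F', Submodule.add_mem _ hF (Submodule.smul_mem _ _ hF'), ?_⟩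
    intro T hT
    have hFS' := avail_Sub hSk hF'
    rw [← add_assoc, weight_add hHF (Submodule.smul_mem _ _ hFS'), weight_smul hFS']
    rcases Nat.lt_succ_iff_lt_or_eq.mp hT with h | h
    · rw [h0 T h, h2 T h]; simp
    · rw [h1 T h, if_pos h]; simp

lemma mem_span {d k : ℕ} {S : Set (HG d)} {V : Finset ℕ} (hV : 2 * k ≤ V.card)
    (hSk : ∀ F ∈ S, IsHG k F) {H : HG d} (hS : SimpleFor k S {H}) (hH : H ∈ Sub d k V) :
    H ∈ Submodule.span ℤ (Avail S V) := by
  obtain ⟨F, hF, h0⟩ := levels hV hSk hS hH (k + 1) le_rfl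
  have hHF := Submodule.add_mem _ hH (avail_Sub hSk hF)
  have hz : H + F = 0 := by
    ext1 e
    by_contra hne
    have hc := (hHF e hne).2
    apply hne
    have := h0 e (by omega)
    rw [weight, Finset.sum_eq_single e] at this
    · exact this
    · intro e' he' hn
      simp only [mem_filter, Finsupp.mem_support_iff] at he'
      have h1 := (hHF e' he'.1).2
      exact absurd (Finset.eq_of_subset_of_card_le he'.2 (by omega)).symm hn
    · intro hn
      by_contra h3
      exact hn (by simpa using h3)
  rw [eq_neg_of_add_eq_zero_left hz]
  exact Submodule.neg_mem _ hF

lemma supports {d k : ℕ} {S : Set (HG d)} {V : Finset ℕ} (hV : 2 * k ≤ V.card)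
    (hSk : ∀ F ∈ S, IsHG k F) {H : HG d} (hS : SimpleFor k S {H}) (hH : H ∈ Sub d k V) :
    Supports V H S := by
  obtain ⟨n, c, g, h⟩ := Submodule.mem_span_set'.mp (mem_span hV hSk hS hH)
  exact ⟨n, c, fun i => (g i).1, fun i => (g i).2.1, fun i => (g i).2.2, h.symm⟩

end SimpleHG

/-- **Theorem (expressibility with simple hypergraphs).**
Let `H = (V, μ)` be a `k`-hypergraph of dimension `d` and let `S` be a family
of `k`-hypergraphs of dimension `d` that is simple for `{H}`.  Then
`H ∈ Σ_ℤ(Eqs(S))`; moreover, if `|V| > 2k − 1`, then `V` supports `H` for the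
family `S`. -/
theorem expressible_with_simple
    (k d : ℕ) (hk : 1 ≤ k) (hd : 1 ≤ d)
    (H : HG d) (hH : IsHG k H)
    (V : Finset ℕ) (hV : verts H ⊆ V)
    (S : Set (HG d)) (hSk : ∀ F ∈ S, IsHG k F) (hS : SimpleFor k S {H}) :
    H ∈ Zsum (Eqs S) ∧ (2 * k - 1 < V.card → Supports V H S) := by
  constructor
  · have h1 : 2 * k ≤ (V ∪ Finset.range (2 * k)).card := by
      have := Finset.card_le_card (Finset.subset_union_right (s₁ := V) (s₂ := Finset.range (2 * k)))
      simpa using this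
    obtain ⟨l, c, F, hF, -, h⟩ := SimpleHG.supports h1 hSk hS
      (SimpleHG.mem_Sub.mpr ⟨hV.trans Finset.subset_union_left, hH⟩)
    exact ⟨l, c, F, hF, h⟩
  · intro hc
    exact SimpleHG.supports (by omega) hSk hS (SimpleHG.mem_Sub.mpr ⟨hV, hH⟩)
end

section
/- For every k-hypergraph G of dimension d there exists a family S′ of k-hypergraphs of dimension d that is simple for {G} and satisfies S′ ⊆ Σ_ℤ(Eqs({G})). -/
section Helpers

variable {d : ℕ}

/-- Hypergraphs all of whose edges are contained in `V`. -/
noncomputable def supIn (d : ℕ) (V : Finset ℕ) : Submodule ℤ (HG d) :=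
  Finsupp.supported (Fin d → ℤ) ℤ {e | e ⊆ V}

/-- Hypergraphs all of whose edges have cardinality `k`. -/
noncomputable def cardIs (d k : ℕ) : Submodule ℤ (HG d) :=
  Finsupp.supported (Fin d → ℤ) ℤ {e | e.card = k}

theorem mem_supIn {V : Finset ℕ} {F : HG d} : F ∈ supIn d V ↔ ∀ e ∈ F.support, e ⊆ V :=
  Iff.rfl

theorem mem_cardIs {k : ℕ} {F : HG d} : F ∈ cardIs d k ↔ IsHG k F :=
  Iff.rfl

theorem verts_subset_iff {V : Finset ℕ} {F : HG d} : verts F ⊆ V ↔ F ∈ supIn d V := by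
  rw [mem_supIn, verts]
  exact Finset.sup_le_iff

theorem supIn_mono {U V : Finset ℕ} (h : U ⊆ V) : supIn d U ≤ supIn d V :=
  fun _ hF e he => (hF he).trans h

/-- Action of a permutation. -/
noncomputable def act (π : ℕ ≃ ℕ) : HG d →ₗ[ℤ] HG d :=
  Finsupp.lmapDomain (Fin d → ℤ) ℤ (Finset.image π)

/-- Add the vertex `v` to each edge. -/
noncomputable def cone (v : ℕ) : HG d →ₗ[ℤ] HG d :=
  Finsupp.lmapDomain (Fin d → ℤ) ℤ (insert v)

/-- The link of the vertex `v`. -/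
noncomputable def link (v : ℕ) (F : HG d) : HG d :=
  (F.filter (fun e => v ∈ e)).mapDomain (fun e => e.erase v)

theorem act_apply (π : ℕ ≃ ℕ) (F : HG d) : act π F = F.mapDomain (Finset.image π) := rfl

theorem cone_apply (v : ℕ) (F : HG d) : cone v F = F.mapDomain (insert v) := rfl

theorem weight_eq_sum (X : Finset ℕ) (F : HG d) :
    weight X F = F.sum (fun e a => if X ⊆ e then a else 0) := by
  rw [weight, Finsupp.sum, Finset.sum_filter]

theorem weight_add (X : Finset ℕ) (F H : HG d) :
    weight X (F + H) = weight X F + weight X H := by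
  simp only [weight_eq_sum]
  apply Finsupp.sum_add_index'
  · intro; simp
  · intro e a b; split_ifs <;> simp

theorem weight_zero (X : Finset ℕ) : weight X (0 : HG d) = 0 := by
  simp [weight_eq_sum]

theorem weight_smul (X : Finset ℕ) (c : ℤ) (F : HG d) :
    weight X (c • F) = c • weight X F := by
  simp only [weight_eq_sum]
  rw [Finsupp.sum_smul_index' (by intro; simp), Finsupp.smul_sum]
  apply Finsupp.sum_congr
  intro e _
  split_ifs <;> simp

theorem weight_neg (X : Finset ℕ) (F : HG d) : weight X (-F) = - weight X F := by
  have := weight_smul X (-1) F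
  simpa using this

theorem weight_sub (X : Finset ℕ) (F H : HG d) :
    weight X (F - H) = weight X F - weight X H := by
  rw [sub_eq_add_neg, weight_add, weight_neg, sub_eq_add_neg]

theorem weight_mapDomain (X : Finset ℕ) (f : Finset ℕ → Finset ℕ) (F : HG d) :
    weight X (F.mapDomain f) = F.sum (fun e a => if X ⊆ f e then a else 0) := by
  rw [weight_eq_sum]
  apply Finsupp.sum_mapDomain_index
  · intro; simp
  · intro e a b; split_ifs <;> simp

theorem weight_cone (X : Finset ℕ) (v : ℕ) (F : HG d) :
    weight X (cone v F) = weight (X.erase v) F := by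
  rw [cone_apply, weight_mapDomain, weight_eq_sum]
  simp only [Finset.subset_insert_iff]

theorem weight_act (X : Finset ℕ) (π : ℕ ≃ ℕ) (F : HG d) :
    weight (X.image π) (act π F) = weight X F := by
  rw [act_apply, weight_mapDomain, weight_eq_sum]
  simp only [Finset.image_subset_image_iff π.injective]

theorem weight_eq_zero {X V : Finset ℕ} {F : HG d} (hF : F ∈ supIn d V) (hX : ¬ X ⊆ V) :
    weight X F = 0 := by
  rw [weight]
  apply Finset.sum_eq_zero
  intro e he
  rw [Finset.mem_filter] at he
  exact absurd (he.2.trans (hF he.1)) hX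

theorem act_eq_self {V : Finset ℕ} {F : HG d} (hF : F ∈ supIn d V) (π : ℕ ≃ ℕ)
    (hπ : ∀ x ∈ V, π x = x) : act π F = F := by
  rw [act_apply]
  conv_rhs => rw [← Finsupp.mapDomain_id (v := F)]
  apply Finsupp.mapDomain_congr
  intro e he
  have : e ⊆ V := hF he
  ext x
  simp only [Finset.mem_image, id]
  constructor
  · rintro ⟨y, hy, rfl⟩
    rwa [hπ y (this hy)]
  · intro hx
    exact ⟨x, hx, hπ x (this hx)⟩

theorem act_cone (π : ℕ ≃ ℕ) (v : ℕ) (F : HG d) :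
    act π (cone v F) = cone (π v) (act π F) := by
  simp only [act_apply, cone_apply, ← Finsupp.mapDomain_comp]
  congr 1
  funext e
  simp [Finset.image_insert]

theorem cone_mem_supIn {V : Finset ℕ} {F : HG d} (hF : F ∈ supIn d V) (v : ℕ) :
    cone v F ∈ supIn d (insert v V) := by
  rw [mem_supIn]
  intro e he
  have := Finsupp.mapDomain_support he
  rw [Finset.mem_image] at this
  obtain ⟨e', he', rfl⟩ := this
  exact Finset.insert_subset_insert _ (hF he')

theorem act_mem_supIn {V : Finset ℕ} {F : HG d} (hF : F ∈ supIn d V) (π : ℕ ≃ ℕ) :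
    act π F ∈ supIn d (V.image π) := by
  rw [mem_supIn]
  intro e he
  have := Finsupp.mapDomain_support he
  rw [Finset.mem_image] at this
  obtain ⟨e', he', rfl⟩ := this
  exact Finset.image_subset_image (hF he')

theorem act_mem_cardIs {k : ℕ} {F : HG d} (hF : F ∈ cardIs d k) (π : ℕ ≃ ℕ) :
    act π F ∈ cardIs d k := by
  rw [mem_cardIs]
  intro e he
  have := Finsupp.mapDomain_support he
  rw [Finset.mem_image] at this
  obtain ⟨e', he', rfl⟩ := this
  rw [Finset.card_image_of_injective _ π.injective]
  exact hF he'

theorem link_mem_cardIs {k : ℕ} {F : HG d} (hF : F ∈ cardIs d (k + 1)) (v : ℕ) :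
    link v F ∈ cardIs d k := by
  rw [mem_cardIs]
  intro e he
  have := Finsupp.mapDomain_support he
  rw [Finset.mem_image] at this
  obtain ⟨e', he', rfl⟩ := this
  rw [Finsupp.support_filter, Finset.mem_filter] at he'
  have h1 : e'.card = k + 1 := hF he'.1
  rw [Finset.card_erase_of_mem he'.2, h1, Nat.add_sub_cancel]

theorem link_mem_supIn {V : Finset ℕ} {F : HG d} (hF : F ∈ supIn d V) (v : ℕ) :
    link v F ∈ supIn d (V.erase v) := by
  rw [mem_supIn]
  intro e he
  have := Finsupp.mapDomain_support he
  rw [Finset.mem_image] at this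
  obtain ⟨e', he', rfl⟩ := this
  rw [Finsupp.support_filter, Finset.mem_filter] at he'
  exact Finset.erase_subset_erase _ (hF he'.1)

theorem cone_link (v : ℕ) (F : HG d) : cone v (link v F) = F.filter (fun e => v ∈ e) := by
  rw [cone_apply, link, ← Finsupp.mapDomain_comp]
  conv_rhs => rw [← Finsupp.mapDomain_id (v := F.filter (fun e => v ∈ e))]
  apply Finsupp.mapDomain_congr
  intro e he
  rw [Finsupp.support_filter, Finset.mem_filter] at he
  simp [Finset.insert_erase he.2]

theorem cone_link_add (v : ℕ) (F : HG d) :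
    F = cone v (link v F) + F.filter (fun e => ¬ v ∈ e) := by
  rw [cone_link]
  exact (Finsupp.filter_add_filter_not F _).symm

theorem rest_mem_supIn {V : Finset ℕ} {F : HG d} (hF : F ∈ supIn d V) (v : ℕ) :
    F.filter (fun e => ¬ v ∈ e) ∈ supIn d (V.erase v) := by
  rw [mem_supIn]
  intro e he
  rw [Finsupp.support_filter, Finset.mem_filter] at he
  exact Finset.subset_erase.2 ⟨hF he.1, he.2⟩

theorem weight_link {X : Finset ℕ} {v : ℕ} (hv : v ∉ X) (F : HG d) :
    weight X (link v F) = weight (insert v X) F := by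
  conv_rhs => rw [cone_link_add v F, weight_add, weight_cone, Finset.erase_insert hv]
  rw [weight_eq_zero (V := (verts F).erase v)
    (rest_mem_supIn (verts_subset_iff.1 subset_rfl) v), add_zero]
  intro h
  have := h (Finset.mem_insert_self v X)
  simp at this

/-- Invariance under permutations. -/
def PermInv (M : Submodule ℤ (HG d)) : Prop := ∀ π : ℕ ≃ ℕ, ∀ F ∈ M, act π F ∈ M

/-- The derived module: those `L` for which `(α - β) L` lies in `M` for generic `α, β`. -/
noncomputable def Der (M : Submodule ℤ (HG d)) (k : ℕ) : Submodule ℤ (HG d) where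
  carrier := {L | L ∈ cardIs d k ∧
    ∃ T : Finset ℕ, ∀ a b, a ∉ T → b ∉ T → cone a L - cone b L ∈ M}
  zero_mem' := ⟨Submodule.zero_mem _, ∅, fun a b _ _ => by simp⟩
  add_mem' := by
    rintro L L' ⟨h, T, hT⟩ ⟨h', T', hT'⟩
    refine ⟨Submodule.add_mem _ h h', T ∪ T', fun a b ha hb => ?_⟩
    rw [Finset.mem_union, not_or] at ha hb
    have := Submodule.add_mem _ (hT a b ha.1 hb.1) (hT' a b ha.2 hb.2)
    rw [map_add, map_add, add_sub_add_comm]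
    exact this
  smul_mem' := by
    rintro c L ⟨h, T, hT⟩
    refine ⟨Submodule.smul_mem _ _ h, T, fun a b ha hb => ?_⟩
    rw [map_smul, map_smul, show c • cone a L - c • cone b L = c • (cone a L - cone b L) from (smul_sub _ _ _).symm]
    exact Submodule.smul_mem _ _ (hT a b ha hb)

theorem Der_le (M : Submodule ℤ (HG d)) (k : ℕ) : Der M k ≤ cardIs d k := fun _ h => h.1

theorem Der_inv {M : Submodule ℤ (HG d)} (hM : PermInv M) (k : ℕ) : PermInv (Der M k) := by
  rintro π L ⟨h, T, hT⟩
  refine ⟨act_mem_cardIs h π, T.image π, fun a b ha hb => ?_⟩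
  have h1 : ∀ a, a ∉ T.image π → π.symm a ∉ T := fun a ha h =>
    ha (Finset.mem_image.2 ⟨_, h, by simp⟩)
  have := hM π _ (hT _ _ (h1 a ha) (h1 b hb))
  rw [map_sub, act_cone, act_cone] at this
  simpa using this

theorem Der_spec {M : Submodule ℤ (HG d)} (hM : PermInv M) {k : ℕ} {L : HG d} (hL : L ∈ Der M k)
    {V : Finset ℕ} (hV : L ∈ supIn d V) {a b : ℕ} (ha : a ∉ V) (hb : b ∉ V) :
    cone a L - cone b L ∈ M := by
  obtain ⟨-, T, hT⟩ := hL
  by_cases hab : a = b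
  · simp [hab]
  obtain ⟨p, hp⟩ := Infinite.exists_notMem_finset (T ∪ V ∪ {a, b})
  obtain ⟨q, hq⟩ := Infinite.exists_notMem_finset (T ∪ V ∪ {a, b, p})
  simp only [Finset.mem_union, Finset.mem_insert, Finset.mem_singleton, not_or] at hp hq
  have h := hM (Equiv.swap a p * Equiv.swap b q) _ (hT p q hp.1.1 hq.1.1)
  rw [map_sub, act_cone, act_cone, act_eq_self hV] at h
  · have h1 : (Equiv.swap a p * Equiv.swap b q) p = a := by
      have n1 : p ≠ b := hp.2.2
      have n2 : p ≠ q := fun h => hq.2.2.2 h.symm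
      rw [Equiv.Perm.mul_apply, Equiv.swap_apply_of_ne_of_ne n1 n2, Equiv.swap_apply_right]
    have h2 : (Equiv.swap a p * Equiv.swap b q) q = b := by
      rw [Equiv.Perm.mul_apply, Equiv.swap_apply_right,
        Equiv.swap_apply_of_ne_of_ne (by tauto) (by tauto)]
    rwa [h1, h2] at h
  · intro x hx
    have n1 : x ≠ a := fun h => ha (h ▸ hx)
    have n2 : x ≠ b := fun h => hb (h ▸ hx)
    have n3 : x ≠ p := fun h => hp.1.2 (h ▸ hx)
    have n4 : x ≠ q := fun h => hq.1.2 (h ▸ hx)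
    rw [Equiv.Perm.mul_apply, Equiv.swap_apply_of_ne_of_ne n2 n4,
      Equiv.swap_apply_of_ne_of_ne n1 n3]

theorem link_mem_Der {M : Submodule ℤ (HG d)} (hM : PermInv M) {k : ℕ} (hk : M ≤ cardIs d (k + 1))
    {F : HG d} (hF : F ∈ M) (v : ℕ) : link v F ∈ Der M k := by
  refine ⟨link_mem_cardIs (hk hF) v, insert v (verts F), fun a b ha hb => ?_⟩
  have hV : F ∈ supIn d (verts F) := verts_subset_iff.1 subset_rfl
  have key : ∀ a, a ∉ insert v (verts F) →
      act (Equiv.swap v a) F = cone a (link v F) + F.filter (fun e => ¬ v ∈ e) := by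
    intro a ha
    rw [Finset.mem_insert, not_or] at ha
    have hfix : ∀ x ∈ (verts F).erase v, Equiv.swap v a x = x := by
      intro x hx
      rw [Finset.mem_erase] at hx
      exact Equiv.swap_apply_of_ne_of_ne hx.1 (fun h => ha.2 (h ▸ hx.2))
    conv_lhs => rw [cone_link_add v F]
    rw [map_add, act_cone, Equiv.swap_apply_left, act_eq_self (link_mem_supIn hV v) _ hfix,
      act_eq_self (rest_mem_supIn hV v) _ hfix]
  have := Submodule.sub_mem _ (hM (Equiv.swap v a) F hF) (hM (Equiv.swap v b) F hF)
  rw [key a ha, key b hb, add_sub_add_right_eq_sub] at this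
  exact this

/-- Elements of `M` supported on few vertices of `V`. -/
def SmallIn (M : Submodule ℤ (HG d)) (n : ℕ) (V : Finset ℕ) : Set (HG d) :=
  {L | L ∈ M ∧ ∃ U : Finset ℕ, U ⊆ V ∧ U.card ≤ n ∧ L ∈ supIn d U}

/-- One elimination step. -/
theorem elim_step {M : Submodule ℤ (HG d)} (hM : PermInv M) {k : ℕ} (hk : M ≤ cardIs d (k + 1))
    (IH : ∀ V : Finset ℕ, ∀ L ∈ Der M k, L ∈ supIn d V →
      L ∈ Submodule.span ℤ (SmallIn (Der M k) (2 * k) V))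
    {V : Finset ℕ} {v : ℕ} (hv : v ∈ V) (hV : 2 * k + 2 ≤ V.card) {F : HG d} (hF : F ∈ M)
    (hFV : F ∈ supIn d V) :
    ∃ H ∈ Submodule.span ℤ (SmallIn M (2 * k + 2) V), H ∈ M ∧ weight ∅ H = 0 ∧
      F - H ∈ supIn d (V.erase v) := by
  have key : ∀ L ∈ Submodule.span ℤ (SmallIn (Der M k) (2 * k) (V.erase v)),
      ∃ H ∈ Submodule.span ℤ (SmallIn M (2 * k + 2) V), H ∈ M ∧ weight ∅ H = 0 ∧
      cone v L - H ∈ supIn d (V.erase v) := by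
    intro L hL
    induction hL using Submodule.span_induction with
    | mem L hL =>
      obtain ⟨hLD, U, hUV, hU, hLU⟩ := hL
      have hcard : U.card < (V.erase v).card := by
        rw [Finset.card_erase_of_mem hv]; omega
      obtain ⟨y, hy, hyU⟩ := Finset.exists_mem_notMem_of_card_lt_card hcard
      have hvU : v ∉ U := fun h => by simpa using hUV h
      have hin := Der_spec hM hLD hLU hvU hyU
      refine ⟨cone v L - cone y L, Submodule.subset_span ⟨hin, insert v (insert y U), ?_, ?_, ?_⟩,
        hin, ?_, ?_⟩
      · have := hUV.trans (Finset.erase_subset v V)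
        exact Finset.insert_subset hv (Finset.insert_subset (Finset.mem_of_mem_erase hy) this)
      · have h1 := Finset.card_insert_le v (insert y U)
        have h2 := Finset.card_insert_le y U
        omega
      · refine Submodule.sub_mem _ (supIn_mono ?_ (cone_mem_supIn hLU v))
          (supIn_mono ?_ (cone_mem_supIn hLU y))
        · exact Finset.insert_subset_insert _ (Finset.subset_insert _ _)
        · exact Finset.subset_insert _ _
      · rw [weight_sub, weight_cone, weight_cone]; simp
      · rw [sub_sub_cancel]
        exact supIn_mono (Finset.insert_subset hy hUV) (cone_mem_supIn hLU y)
    | zero =>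
      exact ⟨0, Submodule.zero_mem _, Submodule.zero_mem _, weight_zero _, by simp⟩
    | add L L' _ _ h h' =>
      obtain ⟨H, h1, h2, h3, h4⟩ := h
      obtain ⟨H', h1', h2', h3', h4'⟩ := h'
      refine ⟨H + H', Submodule.add_mem _ h1 h1', Submodule.add_mem _ h2 h2', ?_, ?_⟩
      · rw [weight_add, h3, h3', add_zero]
      · rw [map_add, add_sub_add_comm]
        exact Submodule.add_mem _ h4 h4'
    | smul c L _ h =>
      obtain ⟨H, h1, h2, h3, h4⟩ := h
      refine ⟨c • H, Submodule.smul_mem _ _ h1, Submodule.smul_mem _ _ h2, ?_, ?_⟩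
      · rw [weight_smul, h3, smul_zero]
      · rw [map_smul, show c • cone v L - c • H = c • (cone v L - H) from (smul_sub _ _ _).symm]
        exact Submodule.smul_mem _ _ h4
  obtain ⟨H, h1, h2, h3, h4⟩ := key (link v F)
    (IH _ _ (link_mem_Der hM hk hF v) (link_mem_supIn hFV v))
  refine ⟨H, h1, h2, h3, ?_⟩
  have : F - H = (cone v (link v F) - H) + F.filter (fun e => ¬ v ∈ e) := by
    conv_lhs => rw [cone_link_add v F]
    abel
  rw [this]
  exact Submodule.add_mem _ h4 (rest_mem_supIn hFV v)

theorem SmallIn_mono {M : Submodule ℤ (HG d)} {n : ℕ} {U V : Finset ℕ} (h : U ⊆ V) :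
    SmallIn M n U ⊆ SmallIn M n V := by
  rintro L ⟨h1, W, h2, h3⟩
  exact ⟨h1, W, h2.trans h, h3⟩

theorem decompose (k : ℕ) : ∀ M : Submodule ℤ (HG d), PermInv M → M ≤ cardIs d k →
    ∀ V : Finset ℕ, ∀ L ∈ M, L ∈ supIn d V →
      L ∈ Submodule.span ℤ (SmallIn M (2 * k) V) := by
  induction k with
  | zero =>
    intro M _ hk V L hL hLV
    refine Submodule.subset_span ⟨hL, ∅, Finset.empty_subset _, by simp, ?_⟩
    intro e he
    have : e.card = 0 := hk hL he
    rw [Finset.card_eq_zero] at this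
    simp [this]
  | succ k ih =>
    intro M hM hk V
    have IH := ih (Der M k) (Der_inv hM k) (Der_le M k)
    induction V using Finset.strongInduction with
    | H V ihV =>
      intro L hL hLV
      by_cases hc : V.card ≤ 2 * (k + 1)
      · exact Submodule.subset_span ⟨hL, V, subset_rfl, hc, hLV⟩
      have hne : V.Nonempty := Finset.card_pos.1 (by omega)
      obtain ⟨v, hv⟩ := hne
      obtain ⟨H, h1, h2, -, h4⟩ := elim_step hM hk IH hv (by omega) hL hLV
      have := ihV _ (Finset.erase_ssubset hv) (L - H) (Submodule.sub_mem _ hL h2) h4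
      have h5 := Submodule.add_mem _
        (Submodule.span_mono (SmallIn_mono (Finset.erase_subset v V)) this) h1
      rwa [sub_add_cancel] at h5

/-- Reduction of the number of vertices, keeping the total weight. -/
theorem reduce {M : Submodule ℤ (HG d)} (hM : PermInv M) {k : ℕ} (hk : M ≤ cardIs d (k + 1))
    (V : Finset ℕ) : ∀ F ∈ M, F ∈ supIn d V →
      ∃ F' ∈ M, weight ∅ F' = weight ∅ F ∧ ∃ U : Finset ℕ, U.card = 2 * k + 1 ∧
        F' ∈ supIn d U := by
  induction V using Finset.strongInduction with
  | H V ihV =>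
    intro F hF hFV
    by_cases hc : V.card ≤ 2 * k + 1
    · obtain ⟨U, hU, hUc⟩ := Infinite.exists_superset_card_eq V _ hc
      exact ⟨F, hF, rfl, U, hUc, supIn_mono hU hFV⟩
    have hne : V.Nonempty := Finset.card_pos.1 (by omega)
    obtain ⟨v, hv⟩ := hne
    obtain ⟨H, h1, h2, h3, h4⟩ := elim_step hM hk
      (decompose k (Der M k) (Der_inv hM k) (Der_le M k)) hv (by omega) hF hFV
    obtain ⟨F', h5, h6, h7⟩ := ihV _ (Finset.erase_ssubset hv) (F - H)
      (Submodule.sub_mem _ hF h2) h4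
    refine ⟨F', h5, ?_, h7⟩
    rw [h6, weight_sub, h3, sub_zero]

theorem isSimple_zero {k : ℕ} {a : Fin d → ℤ} {F : HG d} {C : Finset ℕ}
    (hC : C.card = 2 * k - 1) (hF : F ∈ supIn d C) (ha : weight ∅ F = a) :
    IsSimple k 0 a F := by
  refine ⟨∅, ∅, C, Fin.elim0, Fin.elim0, fun i => i.elim0, fun i => i.elim0, by simp, by simp,
    by simp, by simp, by simp, by simpa using hC, ?_, ?_, ?_, ?_⟩
  · simpa using verts_subset_iff.2 hF
  · intro χ
    simpa using ha
  · intro X _ hX h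
    exact absurd (Finset.card_eq_zero.1 hX) (by simpa using h fun i => i.elim0)
  · intro X _ hX
    omega

theorem image_cons {m : ℕ} (x : ℕ) (f : Fin m → ℕ) :
    Finset.image (Fin.cons x f : Fin (m + 1) → ℕ) Finset.univ =
      insert x (Finset.image f Finset.univ) := by
  ext y
  simp only [Finset.mem_image, Finset.mem_univ, true_and, Finset.mem_insert]
  rw [Fin.exists_fin_succ]
  simp [eq_comm]

theorem isSimple_succ {M : Submodule ℤ (HG d)} (hM : PermInv M) {k m : ℕ} {a : Fin d → ℤ} {L : HG d}
    (hL : L ∈ Der M k) (hS : IsSimple k m a L) :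
    ∃ F ∈ M, IsSimple (k + 1) (m + 1) a F := by
  obtain ⟨A, B, C, α, β, hα, hβ, hA, hB, hAB, hAC, hBC, hC, hV, h1, h2, h3⟩ := hS
  have hLV := verts_subset_iff.1 hV
  set V := A ∪ B ∪ C with hVdef
  obtain ⟨p, hp⟩ := Infinite.exists_notMem_finset V
  obtain ⟨q, hq'⟩ := Infinite.exists_notMem_finset (insert p V)
  rw [Finset.mem_insert, not_or] at hq'
  obtain ⟨hqp, hq⟩ := hq'
  have hw : ∀ X, weight X (cone p L - cone q L) = weight (X.erase p) L - weight (X.erase q) L := by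
    intro X
    rw [weight_sub, weight_cone, weight_cone]
  have hw0 : ∀ X : Finset ℕ, p ∉ X → q ∉ X → weight X (cone p L - cone q L) = 0 := by
    intro X hpX hqX
    rw [hw, Finset.erase_eq_of_notMem hpX, Finset.erase_eq_of_notMem hqX, sub_self]
  have hw1 : ∀ X : Finset ℕ, p ∈ X → weight (X.erase q) L = 0 := by
    intro X hpX
    exact weight_eq_zero hLV fun h => hp (h (Finset.mem_erase.2 ⟨Ne.symm hqp, hpX⟩))
  have hw2 : ∀ X : Finset ℕ, q ∈ X → weight (X.erase p) L = 0 := by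
    intro X hqX
    exact weight_eq_zero hLV fun h => hq (h (Finset.mem_erase.2 ⟨hqp, hqX⟩))
  have hpA : p ∉ A := fun h => hp (by simp [hVdef, h])
  have hpB : p ∉ B := fun h => hp (by simp [hVdef, h])
  have hpC : p ∉ C := fun h => hp (by simp [hVdef, h])
  have hqA : q ∉ A := fun h => hq (by simp [hVdef, h])
  have hqB : q ∉ B := fun h => hq (by simp [hVdef, h])
  have hqC : q ∉ C := fun h => hq (by simp [hVdef, h])
  have hUV : insert p A ∪ insert q B ∪ C = insert p (insert q V) := by
    ext x; simp only [hVdef, Finset.mem_union, Finset.mem_insert]; tauto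
  have himg : ∀ χ : Fin (m + 1) → Bool,
      Finset.image (fun i => if χ i then (Fin.cons q β : Fin (m + 1) → ℕ) i
        else (Fin.cons p α : Fin (m + 1) → ℕ) i) Finset.univ =
      insert (if χ 0 then q else p)
        (Finset.image (fun i => if χ (Fin.succ i) then β i else α i) Finset.univ) := by
    intro χ
    rw [← image_cons]
    congr 1
    funext i
    refine Fin.cases ?_ (fun i => ?_) i <;> simp
  have hsub : ∀ χ : Fin m → Bool,
      Finset.image (fun i => if χ i then β i else α i) Finset.univ ⊆ V := by
    intro χ x hx
    simp only [Finset.mem_image, Finset.mem_univ, true_and] at hx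
    obtain ⟨i, rfl⟩ := hx
    have ha : α i ∈ A := by rw [hA]; simp
    have hb : β i ∈ B := by rw [hB]; simp
    split_ifs <;> simp [hVdef, ha, hb]
  refine ⟨cone p L - cone q L, Der_spec hM hL hLV hp hq, insert p A, insert q B, C,
    Fin.cons p α, Fin.cons q β, ?_, ?_, ?_, ?_, ?_, ?_, ?_, ?_, ?_, ?_, ?_, ?_⟩
  · rw [Fin.cons_injective_iff]
    refine ⟨?_, hα⟩
    rintro ⟨i, rfl⟩
    exact hpA (by rw [hA]; simp)
  · rw [Fin.cons_injective_iff]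
    refine ⟨?_, hβ⟩
    rintro ⟨i, rfl⟩
    exact hqB (by rw [hB]; simp)
  · rw [image_cons, hA]
  · rw [image_cons, hB]
  · rw [Finset.disjoint_insert_left, Finset.disjoint_insert_right, Finset.mem_insert]
    exact ⟨by rintro (h | h); exacts [hqp h.symm, hpB h], hqA, hAB⟩
  · rw [Finset.disjoint_insert_left]; exact ⟨hpC, hAC⟩
  · rw [Finset.disjoint_insert_left]; exact ⟨hqC, hBC⟩
  · rw [hC]; congr 2; omega
  · rw [hUV, verts_subset_iff]
    refine Submodule.sub_mem _ (supIn_mono ?_ (cone_mem_supIn hLV p))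
      (supIn_mono ?_ (cone_mem_supIn hLV q))
    · exact Finset.insert_subset_insert _ (Finset.subset_insert _ _)
    · exact Finset.subset_insert _ _
  · intro χ
    rw [himg, hw]
    have hs := hsub (fun i => χ (Fin.succ i))
    have hh := h1 (fun i => χ (Fin.succ i))
    have hcount : (Finset.univ.filter (fun i => χ i = true)).card =
        (if χ 0 = true then 1 else 0) +
          (Finset.univ.filter (fun i : Fin m => χ (Fin.succ i) = true)).card := by
      simp only [Finset.card_filter]
      exact Fin.sum_univ_succ _
    rw [hcount]
    by_cases h0 : χ 0 = true
    · simp only [h0, if_true]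
      rw [hw2 _ (Finset.mem_insert_self _ _), Finset.erase_insert (fun h => hq (hs h)), hh,
        pow_add, pow_one, neg_one_mul, neg_smul, zero_sub]
    · simp only [h0, if_false, Bool.false_eq_true, zero_add]
      rw [hw1 _ (Finset.mem_insert_self _ _), Finset.erase_insert (fun h => hp (hs h)), hh, sub_zero]
  · intro X hX hXc hne
    rw [hUV] at hX
    by_cases hpX : p ∈ X
    · rw [hw, hw1 X hpX, sub_zero]
      by_cases hqX : q ∈ X
      · exact hw2 X hqX
      apply h2
      · intro x hx
        rw [Finset.mem_erase] at hx
        have := hX hx.2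
        rw [Finset.mem_insert, Finset.mem_insert] at this
        rcases this with h | h | h
        · exact absurd h hx.1
        · exact absurd (h ▸ hx.2) hqX
        · exact h
      · rw [Finset.card_erase_of_mem hpX, hXc]; rfl
      · intro χ hχ
        apply hne (Fin.cons false χ)
        rw [himg]
        simp only [Fin.cons_zero, Fin.cons_succ, ← hχ]
        simp [Finset.insert_erase hpX]
    · by_cases hqX : q ∈ X
      · rw [hw, hw2 X hqX, zero_sub, neg_eq_zero]
        apply h2
        · intro x hx
          rw [Finset.mem_erase] at hx
          have := hX hx.2
          rw [Finset.mem_insert, Finset.mem_insert] at this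
          rcases this with h | h | h
          · exact absurd (h ▸ hx.2) hpX
          · exact absurd h hx.1
          · exact h
        · rw [Finset.card_erase_of_mem hqX, hXc]; rfl
        · intro χ hχ
          apply hne (Fin.cons true χ)
          rw [himg]
          simp only [Fin.cons_zero, Fin.cons_succ, ← hχ]
          simp [Finset.insert_erase hqX]
      · exact hw0 X hpX hqX
  · intro X hX hXc
    have hz : ∀ x ∈ X, weight (X.erase x) L = 0 := by
      intro x hx
      by_cases hs : X.erase x ⊆ V
      · apply h3 _ hs
        rw [Finset.card_erase_of_mem hx]
        have := Finset.card_pos.2 ⟨x, hx⟩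
        omega
      · exact weight_eq_zero hLV hs
    by_cases hpX : p ∈ X
    · rw [hw, hw1 X hpX, hz p hpX, sub_zero]
    · by_cases hqX : q ∈ X
      · rw [hw, hw2 X hqX, hz q hqX, sub_zero]
      · exact hw0 X hpX hqX

theorem exists_isSimple (k : ℕ) : ∀ M : Submodule ℤ (HG d), PermInv M → M ≤ cardIs d k →
    ∀ m ≤ k, ∀ X : Finset ℕ, X.card = m → ∀ F ∈ M,
      ∃ F' ∈ M, IsSimple k m (weight X F) F' := by
  induction k with
  | zero =>
    intro M _ hk m hm X hX F hF
    obtain rfl : m = 0 := by omega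
    rw [Finset.card_eq_zero] at hX
    subst hX
    refine ⟨F, hF, isSimple_zero (C := ∅) (by simp) ?_ rfl⟩
    intro e he
    have : e.card = 0 := hk hF he
    rw [Finset.card_eq_zero] at this
    simp [this]
  | succ k ih =>
    intro M hM hk m hm X hX F hF
    cases m with
    | zero =>
      rw [Finset.card_eq_zero] at hX
      subst hX
      obtain ⟨F', h1, h2, U, h3, h4⟩ :=
        reduce hM hk (verts F) F hF (verts_subset_iff.1 subset_rfl)
      exact ⟨F', h1, isSimple_zero (C := U) (by omega) h4 h2⟩
    | succ m =>
      obtain ⟨v, hv⟩ : X.Nonempty := Finset.card_pos.1 (by omega)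
      obtain ⟨L, hL, hS⟩ := ih (Der M k) (Der_inv hM k) (Der_le M k) m (by omega) (X.erase v)
        (by rw [Finset.card_erase_of_mem hv, hX]; rfl) (link v F) (link_mem_Der hM hk hF v)
      rw [weight_link (by simp), Finset.insert_erase hv] at hS
      exact isSimple_succ hM hL hS

theorem exists_perm_image {X Y : Finset ℕ} (h : X.card = Y.card) :
    ∃ π : ℕ ≃ ℕ, X.image π = Y := by
  obtain ⟨σ, hσ⟩ := Equiv.Perm.exists_extending_pair (fun x : X => (x : ℕ))
    (fun x : X => ((Finset.equivOfCardEq h x : Y) : ℕ)) Subtype.val_injective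
    (Subtype.val_injective.comp (Finset.equivOfCardEq h).injective)
  refine ⟨σ, ?_⟩
  have hs : X.image σ ⊆ Y := by
    intro y hy
    rw [Finset.mem_image] at hy
    obtain ⟨x, hx, rfl⟩ := hy
    have := hσ ⟨x, hx⟩
    simp only at this
    rw [this]
    exact Subtype.property _
  exact Finset.eq_of_subset_of_card_le hs
    (by rw [Finset.card_image_of_injective _ σ.injective, h])

theorem span_weights {M : Submodule ℤ (HG d)} (hM : PermInv M) {m : ℕ} {S : Set (HG d)}
    (hS : S ⊆ M) {g : Fin d → ℤ}
    (hg : g ∈ Submodule.span ℤ {w : Fin d → ℤ | ∃ G ∈ S, ∃ X : Finset ℕ,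
        X ⊆ verts G ∧ X.card = m ∧ w = weight X G}) :
    ∃ F ∈ M, weight (Finset.range m) F = g := by
  induction hg using Submodule.span_induction with
  | mem g hg =>
    obtain ⟨G, hG, X, -, hX, rfl⟩ := hg
    obtain ⟨π, hπ⟩ := exists_perm_image (X := X) (Y := Finset.range m) (by simpa using hX)
    exact ⟨act π G, hM π _ (hS hG), by rw [← hπ, weight_act]⟩
  | zero => exact ⟨0, Submodule.zero_mem _, weight_zero _⟩
  | add g g' _ _ h h' =>
    obtain ⟨F, h1, h2⟩ := h
    obtain ⟨F', h1', h2'⟩ := h'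
    exact ⟨F + F', Submodule.add_mem _ h1 h1', by rw [weight_add, h2, h2']⟩
  | smul c g _ h =>
    obtain ⟨F, h1, h2⟩ := h
    exact ⟨c • F, Submodule.smul_mem _ _ h1, by rw [weight_smul, h2]⟩

theorem isSimplificationOf {M : Submodule ℤ (HG d)} (hM : PermInv M) {k : ℕ} (hk : M ≤ cardIs d k)
    {S : Set (HG d)} (hS : S ⊆ M) : IsSimplificationOf k (M : Set (HG d)) S := by
  intro m hm g hg
  obtain ⟨F, hF, rfl⟩ := span_weights hM hS hg
  exact exists_isSimple k M hM hk m hm _ (by simp) F hF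

theorem hgEquiv_iff {G H : HG d} : HGEquiv G H ↔ ∃ π : ℕ ≃ ℕ, H = act π G := by
  constructor
  · rintro ⟨π, hπ⟩
    refine ⟨π, ?_⟩
    ext1 e
    have he : e = (e.image π.symm).image π := by
      simp [Finset.image_image]
    rw [he, hπ, act_apply, Finsupp.mapDomain_apply (Finset.image_injective π.injective)]
  · rintro ⟨π, rfl⟩
    exact ⟨π, fun e => by
      rw [act_apply, Finsupp.mapDomain_apply (Finset.image_injective π.injective)]⟩

theorem act_act (π σ : ℕ ≃ ℕ) (F : HG d) : act π (act σ F) = act (σ.trans π) F := by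
  simp only [act_apply, ← Finsupp.mapDomain_comp]
  congr 1
  funext e
  simp [Finset.image_image]

theorem span_inv (G : HG d) : PermInv (Submodule.span ℤ (Eqs {G})) := by
  intro π F hF
  induction hF using Submodule.span_induction with
  | mem F hF =>
    obtain ⟨G', rfl, h⟩ := hF
    obtain ⟨σ, rfl⟩ := hgEquiv_iff.1 h
    exact Submodule.subset_span ⟨_, rfl, hgEquiv_iff.2 ⟨_, act_act π σ _⟩⟩
  | zero => simp
  | add F F' _ _ h h' => rw [map_add]; exact Submodule.add_mem _ h h'
  | smul c F _ h => rw [map_smul]; exact Submodule.smul_mem _ _ h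

end Helpers

/-- **Theorem (existence of simple families).**
For every `k`-hypergraph `G` of dimension `d` there exists a family `S'` of
`k`-hypergraphs of dimension `d` that is simple for `{G}` and satisfies
`S' ⊆ Σ_ℤ(Eqs({G}))`. -/
theorem exists_simple_family
    (k d : ℕ) (hk : 1 ≤ k) (hd : 1 ≤ d)
    (G : HG d) (hG : IsHG k G) :
    ∃ S' : Set (HG d), (∀ F ∈ S', IsHG k F) ∧ SimpleFor k S' {G} ∧
      S' ⊆ Zsum (Eqs {G}) := by

  have hM := span_inv G
  have hGE : G ∈ Eqs {G} := ⟨G, rfl, Equiv.refl ℕ, fun e => by simp⟩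
  have hk' : Submodule.span ℤ (Eqs {G}) ≤ cardIs d k := by
    rw [Submodule.span_le]
    rintro F ⟨G', rfl, h⟩
    obtain ⟨σ, rfl⟩ := hgEquiv_iff.1 h
    exact act_mem_cardIs hG σ
  refine ⟨(Submodule.span ℤ (Eqs {G}) : Submodule ℤ (HG d)), fun F hF => hk' hF,
    ⟨isSimplificationOf hM hk' subset_rfl, isSimplificationOf hM hk' ?_⟩, ?_⟩
  · rintro F rfl
    exact Submodule.subset_span hGE
  · intro F hF
    obtain ⟨n, f, g, h⟩ := Submodule.mem_span_set'.1 hF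
    exact ⟨n, f, fun i => g i, fun i => (g i).2, h.symm⟩
end

section
/- Let G = (V′, μ′) be a k-hypergraph of dimension d and let X be an m-element subset of V′ with m ≤ k; set a = w_X(G). Then there exists an (m,a)-simple k-hypergraph S^m_a such that S^m_a ∈ Σ_ℤ(Eqs({G})). -/
namespace SH
open Finset

variable {d : ℕ}

theorem hom_ext {B : Type*} [AddCommMonoid B] (f g : HG d →+ B) (H : HG d)
    (h : ∀ e ∈ H.support, ∀ a, f (Finsupp.single e a) = g (Finsupp.single e a)) : f H = g H := by
  rw [← Finsupp.sum_single H, Finsupp.sum, map_sum, map_sum]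
  exact Finset.sum_congr rfl fun e he => h e he _

noncomputable def ins (x : ℕ) : HG d →+ HG d := Finsupp.mapDomain.addMonoidHom (insert x)

noncomputable def D (x y : ℕ) : HG d →+ HG d := ins x - ins y

noncomputable def act (π : ℕ ≃ ℕ) : HG d →+ HG d :=
  Finsupp.mapDomain.addMonoidHom (Finset.image π)

noncomputable def link (v : ℕ) : HG d →+ HG d :=
  Finsupp.liftAddHom fun e => if v ∈ e then Finsupp.singleAddHom (e.erase v) else 0

noncomputable def wt (X : Finset ℕ) : HG d →+ (Fin d → ℤ) :=
  Finsupp.liftAddHom fun e => if X ⊆ e then AddMonoidHom.id _ else 0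

theorem weight_eq (X : Finset ℕ) (H : HG d) : weight X H = wt X H := by
  simp only [weight, wt, Finsupp.liftAddHom_apply, Finsupp.sum, Finset.sum_filter]
  refine Finset.sum_congr rfl fun e _ => ?_
  split_ifs <;> simp

theorem ins_single (x : ℕ) (e : Finset ℕ) (a : Fin d → ℤ) :
    ins x (Finsupp.single e a) = Finsupp.single (insert x e) a := by
  simp [ins, Finsupp.mapDomain_single]

theorem D_apply (x y : ℕ) (K : HG d) : D x y K = ins x K - ins y K := rfl

theorem D_single (x y : ℕ) (e : Finset ℕ) (a : Fin d → ℤ) :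
    D x y (Finsupp.single e a) = Finsupp.single (insert x e) a - Finsupp.single (insert y e) a := by
  rw [D_apply, ins_single, ins_single]

theorem act_single (π : ℕ ≃ ℕ) (e : Finset ℕ) (a : Fin d → ℤ) :
    act π (Finsupp.single e a) = Finsupp.single (e.image π) a := by
  simp [act, Finsupp.mapDomain_single]

theorem link_single (v : ℕ) (e : Finset ℕ) (a : Fin d → ℤ) :
    link v (Finsupp.single e a) = if v ∈ e then Finsupp.single (e.erase v) a else 0 := by
  simp only [link, Finsupp.liftAddHom_apply_single]
  split_ifs <;> simp

theorem wt_single (X e : Finset ℕ) (a : Fin d → ℤ) :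
    wt X (Finsupp.single e a) = if X ⊆ e then a else 0 := by
  simp only [wt, Finsupp.liftAddHom_apply_single]
  split_ifs <;> simp

/-- `H` is an `r`-hypergraph on `V`. -/
def On (r : ℕ) (V : Finset ℕ) (H : HG d) : Prop := H.support ⊆ powersetCard r V

theorem On.mem {r : ℕ} {V : Finset ℕ} {H : HG d} (h : On r V H) {e : Finset ℕ}
    (he : e ∈ H.support) : e ⊆ V ∧ e.card = r := mem_powersetCard.1 (h he)

theorem On.mono {r : ℕ} {V W : Finset ℕ} {H : HG d} (h : On r V H) (hVW : V ⊆ W) : On r W H :=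
  h.trans (powersetCard_mono hVW)

theorem on_zero (r : ℕ) (V : Finset ℕ) : On r V (0 : HG d) := by simp [On]

theorem On.add {r : ℕ} {V : Finset ℕ} {H K : HG d} (h : On r V H) (k : On r V K) :
    On r V (H + K) := Finsupp.support_add.trans (union_subset h k)

theorem On.neg {r : ℕ} {V : Finset ℕ} {H : HG d} (h : On r V H) : On r V (-H) := by
  unfold On; rw [Finsupp.support_neg]; exact h

theorem On.sub {r : ℕ} {V : Finset ℕ} {H K : HG d} (h : On r V H) (k : On r V K) :
    On r V (H - K) := by rw [sub_eq_add_neg]; exact h.add k.neg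

theorem on_single {r : ℕ} {V e : Finset ℕ} (a : Fin d → ℤ) (h1 : e ⊆ V) (h2 : e.card = r) :
    On r V (Finsupp.single e a) :=
  Finsupp.support_single_subset.trans (by simp [h1, h2])

theorem on_map {r s : ℕ} {V W : Finset ℕ} (f : HG d →+ HG d) {H : HG d} (hH : On r V H)
    (h : ∀ e, e ⊆ V → e.card = r → ∀ a, On s W (f (Finsupp.single e a))) : On s W (f H) := by
  rw [← Finsupp.sum_single H, Finsupp.sum, map_sum]
  have : ∀ t : Finset (Finset ℕ), t ⊆ H.support →
      On s W (∑ e ∈ t, f (Finsupp.single e (H e))) := by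
    intro t
    induction t using Finset.induction_on with
    | empty => intro _; simpa using on_zero s W
    | insert e t he ih =>
      intro ht
      rw [sum_insert he]
      have := hH.mem (ht (mem_insert_self _ _))
      exact (h e this.1 this.2 _).add (ih fun x hx => ht (mem_insert_of_mem hx))
  exact this _ (Subset.refl _)

theorem on_D {r : ℕ} {V : Finset ℕ} {H : HG d} (hH : On r V H) {x y : ℕ} (hx : x ∉ V)
    (hy : y ∉ V) : On (r+1) (insert x (insert y V)) (D x y H) := by
  refine on_map _ hH fun e he hc a => ?_
  rw [D_single]
  refine (on_single _ ?_ ?_).sub (on_single _ ?_ ?_)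
  · grind
  · rw [card_insert_of_notMem (fun h => hx (he h)), hc]
  · grind
  · rw [card_insert_of_notMem (fun h => hy (he h)), hc]

theorem on_link {r : ℕ} {V : Finset ℕ} {H : HG d} (hH : On (r+1) V H) (v : ℕ) :
    On r (V.erase v) (link v H) := by
  refine on_map _ hH fun e he hc a => ?_
  rw [link_single]
  split_ifs with h
  · exact on_single _ (erase_subset_erase _ he) (by rw [card_erase_of_mem h, hc]; rfl)
  · exact on_zero _ _

theorem D_link {r : ℕ} {V : Finset ℕ} {H : HG d} (hH : On r V H) {v y : ℕ} (hy : y ∉ V) :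
    D v y (link v H) = H - act (Equiv.swap v y) H := by
  have := hom_ext ((D v y).comp (link v)) (AddMonoidHom.id _ - act (Equiv.swap v y)) H ?_
  · simpa using this
  · intro e he a
    have hye : y ∉ e := fun h => hy ((hH.mem he).1 h)
    simp only [AddMonoidHom.comp_apply, AddMonoidHom.sub_apply, AddMonoidHom.id_apply, link_single,
      act_single]
    split_ifs with h
    · rw [D_single, insert_erase h]
      congr 2
      ext z
      simp only [mem_insert, mem_erase, mem_image, Equiv.swap_apply_def]
      grind
    · rw [map_zero, eq_comm, sub_eq_zero]
      congr 1
      ext z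
      simp only [mem_image, Equiv.swap_apply_def]
      grind

theorem link_D {r : ℕ} {V : Finset ℕ} {Q : HG d} (hQ : On r V Q) {v z : ℕ} (hv : v ∉ V)
    (hz : z ≠ v) : link v (D v z Q) = Q := by
  refine hom_ext ((link v).comp (D v z)) (AddMonoidHom.id _) Q ?_
  intro e he a
  have hve : v ∉ e := fun h => hv ((hQ.mem he).1 h)
  simp only [AddMonoidHom.comp_apply, D_single, map_sub, link_single, AddMonoidHom.id_apply]
  rw [if_pos (mem_insert_self _ _), if_neg (by grind), erase_insert hve, sub_zero]

theorem link_apply (v : ℕ) (H : HG d) (e : Finset ℕ) (he : v ∈ e) :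
    link v H (e.erase v) = H e := by
  refine hom_ext ((Finsupp.applyAddHom (e.erase v)).comp (link v)) (Finsupp.applyAddHom e) H ?_
  intro f _ a
  simp only [AddMonoidHom.comp_apply, link_single, Finsupp.applyAddHom_apply]
  split_ifs with h
  · simp only [Finsupp.single_apply]
    have : f.erase v = e.erase v ↔ f = e := by
      constructor
      · intro h'; rw [← insert_erase h, h', insert_erase he]
      · rintro rfl; rfl
    simp [this]
  · rw [Finsupp.single_apply, if_neg (by rintro rfl; exact h he)]; rfl

theorem on_erase {r : ℕ} {V : Finset ℕ} {H : HG d} (hH : On r V H) {v : ℕ}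
    (h : link v H = 0) : On r (V.erase v) H := by
  intro e he
  have h1 := hH.mem he
  rw [mem_powersetCard]
  refine ⟨?_, h1.2⟩
  intro x hx
  refine mem_erase.2 ⟨?_, h1.1 hx⟩
  rintro rfl
  have := link_apply x H e hx
  rw [h] at this
  exact (Finsupp.mem_support_iff.1 he) this.symm

theorem wt_D_zero (X : Finset ℕ) {x y : ℕ} (hx : x ∉ X) (hy : y ∉ X) (K : HG d) :
    wt X (D x y K) = 0 := by
  refine hom_ext ((wt X).comp (D x y)) 0 K ?_
  intro e _ a
  simp only [AddMonoidHom.comp_apply, D_single, map_sub, wt_single]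
  simp only [subset_insert_iff_of_notMem hx, subset_insert_iff_of_notMem hy, sub_self]; rfl

theorem wt_D_left {r : ℕ} {V : Finset ℕ} {K : HG d} (hK : On r V K) (Y : Finset ℕ) {x y : ℕ}
    (hx : x ∉ V) (hxY : x ∉ Y) (hxy : x ≠ y) :
    wt (insert x Y) (D x y K) = wt Y K := by
  refine hom_ext ((wt (insert x Y)).comp (D x y)) (wt Y) K ?_
  intro e he a
  have hxe : x ∉ e := fun h => hx ((hK.mem he).1 h)
  simp only [AddMonoidHom.comp_apply, D_single, map_sub, wt_single]
  simp only [insert_subset_insert_iff hxY]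
  rw [if_neg (c := insert x Y ⊆ insert y e), sub_zero]
  intro h
  have := h (mem_insert_self _ _)
  grind

theorem D_swap (x y : ℕ) (K : HG d) : D x y K = - D y x K := by
  rw [D_apply, D_apply, neg_sub]

theorem D_comm (x y x' y' : ℕ) (K : HG d) : D x y (D x' y' K) = D x' y' (D x y K) := by
  refine hom_ext ((D x y).comp (D x' y')) ((D x' y').comp (D x y)) K ?_
  intro e _ a
  simp only [AddMonoidHom.comp_apply, D_single, map_sub]
  rw [Finset.insert_comm x x', Finset.insert_comm y x', Finset.insert_comm x y', Finset.insert_comm y y']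
  abel

theorem act_D (π : ℕ ≃ ℕ) (x y : ℕ) (K : HG d) :
    act π (D x y K) = D (π x) (π y) (act π K) := by
  refine hom_ext ((act π).comp (D x y)) ((D (π x) (π y)).comp (act π)) K ?_
  intro e _ a
  simp only [AddMonoidHom.comp_apply, D_single, map_sub, act_single, image_insert]

theorem act_on {r : ℕ} {V : Finset ℕ} {K : HG d} (hK : On r V K) (π : ℕ ≃ ℕ)
    (h : ∀ x ∈ V, π x = x) : act π K = K := by
  refine hom_ext (act π) (AddMonoidHom.id _) K ?_
  intro e he a
  rw [act_single, AddMonoidHom.id_apply]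
  congr 1
  have : e.image π = e.image id :=
    image_congr fun x hx => h x ((hK.mem he).1 hx)
  rw [this, image_id]

theorem wt_link (v : ℕ) (Y : Finset ℕ) (hv : v ∉ Y) (H : HG d) :
    wt Y (link v H) = wt (insert v Y) H := by
  refine hom_ext ((wt Y).comp (link v)) (wt (insert v Y)) H ?_
  intro e _ a
  simp only [AddMonoidHom.comp_apply, link_single, wt_single]
  by_cases h : v ∈ e
  · rw [if_pos h, wt_single]
    congr 1
    rw [eq_iff_iff, insert_subset_iff, subset_erase]
    tauto
  · rw [if_neg h, map_zero, if_neg]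
    intro h'; exact h (h' (mem_insert_self _ _))

/-- Invariance under permutations fixing `F`. -/
def Inv (F : Finset ℕ) (M : AddSubgroup (HG d)) : Prop :=
  ∀ π : ℕ ≃ ℕ, (∀ x ∈ F, π x = x) → ∀ H ∈ M, act π H ∈ M

theorem Inv.comap {F : Finset ℕ} {M : AddSubgroup (HG d)} (h : Inv F M) (x y : ℕ) :
    Inv (insert x (insert y F)) (M.comap (D x y)) := by
  intro π hπ H hH
  rw [AddSubgroup.mem_comap] at hH ⊢
  have := h π (fun z hz => hπ z (by simp [hz])) _ hH
  rwa [act_D, hπ x (by simp), hπ y (by simp)] at this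

/-- The subgroup generated by elements of `M` on at most `2r` vertices of `V`. -/
noncomputable def gen (M : AddSubgroup (HG d)) (r : ℕ) (V : Finset ℕ) : AddSubgroup (HG d) :=
  AddSubgroup.closure {T | T ∈ M ∧ ∃ W ⊆ V, W.card ≤ 2 * r ∧ On r W T}

theorem gen_mono (M : AddSubgroup (HG d)) (r : ℕ) {V V' : Finset ℕ} (h : V ⊆ V') :
    gen M r V ≤ gen M r V' :=
  AddSubgroup.closure_mono fun _ ⟨h1, W, h2, h3⟩ => ⟨h1, W, h2.trans h, h3⟩

theorem gen_le (M : AddSubgroup (HG d)) (r : ℕ) (V : Finset ℕ) : gen M r V ≤ M :=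
  (AddSubgroup.closure_le _).2 fun _ h => h.1

theorem gen_on {M : AddSubgroup (HG d)} {r : ℕ} {V : Finset ℕ} {T : HG d} (h : T ∈ gen M r V) :
    On r V T := by
  refine AddSubgroup.closure_induction (p := fun T _ => On r V T) ?_ (on_zero _ _)
    (fun _ _ _ _ => On.add) (fun _ _ => On.neg) h
  rintro T ⟨_, W, hW, _, h⟩
  exact h.mono hW

def Claim (d r : ℕ) : Prop :=
  ∀ (M : AddSubgroup (HG d)) (F V : Finset ℕ) (H : HG d), Inv F M → Disjoint V F → H ∈ M →
    On r V H → H ∈ gen M r V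

theorem step {r : ℕ} (hr : Claim d r) (M : AddSubgroup (HG d)) (F V : Finset ℕ) (H : HG d)
    (hM : Inv F M) (hVF : Disjoint V F) (hH : H ∈ M) (hV : On (r+1) V H)
    (hc : 2 * (r + 1) ≤ V.card) (v : ℕ) (hv : v ∈ V) :
    ∃ T ∈ gen M (r+1) V, link v T = link v H ∧ wt ∅ T = 0 := by
  obtain ⟨y, hy⟩ := Infinite.exists_notMem_finset (V ∪ F)
  rw [mem_union, not_or] at hy
  have hvF : v ∉ F := disjoint_left.1 hVF hv
  have h1 : link v H ∈ M.comap (D v y) := by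
    rw [AddSubgroup.mem_comap, D_link hV hy.1]
    refine M.sub_mem hH (hM _ ?_ _ hH)
    intro x hx
    exact Equiv.swap_apply_of_ne_of_ne (by grind) (by grind)
  have h2 := hr _ _ (V.erase v) _ (hM.comap v y) (by
    rw [disjoint_left] at hVF ⊢; grind) h1 (on_link hV v)
  refine AddSubgroup.closure_induction
    (p := fun Q _ => ∃ T ∈ gen M (r+1) V, link v T = Q ∧ wt ∅ T = 0) ?_ ?_ ?_ ?_ h2
  · rintro Q ⟨hQ, W, hW, hWc, hQW⟩
    have : ∃ z ∈ V.erase v, z ∉ W := by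
      apply exists_mem_notMem_of_card_lt_card
      rw [card_erase_of_mem hv]; omega
    obtain ⟨z, hz, hzW⟩ := this
    have hzv : z ≠ v := (mem_erase.1 hz).1
    have hzV : z ∈ V := (mem_erase.1 hz).2
    have hvW : v ∉ W := fun h => (mem_erase.1 (hW h)).1 rfl
    have hyW : y ∉ W := fun h => hy.1 (mem_erase.1 (hW h)).2
    have hvy : v ≠ y := by rintro rfl; exact hy.1 hv
    refine ⟨D v z Q, AddSubgroup.subset_closure ⟨?_, insert v (insert z W), ?_, ?_, ?_⟩, ?_, ?_⟩
    · rw [AddSubgroup.mem_comap] at hQ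
      have := hM (Equiv.swap y z) (fun x hx => Equiv.swap_apply_of_ne_of_ne (by grind)
        (by rintro rfl; exact disjoint_left.1 hVF hzV hx)) _ hQ
      rwa [act_D, Equiv.swap_apply_left, Equiv.swap_apply_of_ne_of_ne hvy hzv.symm,
        act_on hQW] at this
      intro x hx
      exact Equiv.swap_apply_of_ne_of_ne (by grind) (by grind)
    · grind
    · have := card_insert_le v (insert z W)
      have := card_insert_le z W
      omega
    · exact on_D hQW hvW hzW
    · exact link_D hQW hvW hzv
    · exact wt_D_zero _ (by simp) (by simp) _
  · exact ⟨0, zero_mem _, map_zero _, map_zero _⟩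
  · rintro Q Q' _ _ ⟨T, h1, h2, h3⟩ ⟨T', h1', h2', h3'⟩
    exact ⟨T + T', add_mem h1 h1', by rw [map_add, h2, h2'], by rw [map_add, h3, h3', add_zero]⟩
  · rintro Q _ ⟨T, h1, h2, h3⟩
    exact ⟨-T, neg_mem h1, by rw [map_neg, h2], by rw [map_neg, h3, neg_zero]⟩

theorem claim (r : ℕ) : Claim d r := by
  induction r with
  | zero =>
    intro M F V H _ _ hH hV
    refine AddSubgroup.subset_closure ⟨hH, ∅, by simp, by simp, ?_⟩
    intro e he
    have := (hV.mem he).2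
    simpa using this
  | succ r ih =>
    intro M F V
    induction V using Finset.strongInduction with
    | H V ihV =>
      intro H hM hVF hH hV
      by_cases hc : V.card ≤ 2 * (r + 1)
      · exact AddSubgroup.subset_closure ⟨hH, V, Subset.refl _, hc, hV⟩
      · have : V.Nonempty := by rw [← card_pos]; omega
        obtain ⟨v, hv⟩ := this
        obtain ⟨T, h1, h2, _⟩ := step ih M F V H hM hVF hH hV (by omega) v hv
        have h4 := ihV (V.erase v) (erase_ssubset hv) (H - T) hM
          (hVF.mono_left (erase_subset _ _)) (sub_mem hH (gen_le _ _ _ h1))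
          (on_erase (hV.sub (gen_on h1)) (by rw [map_sub, h2, sub_self]))
        have := add_mem (gen_mono M (r+1) (erase_subset v V) h4) h1
        rwa [sub_add_cancel] at this

theorem claim2 (r : ℕ) (M : AddSubgroup (HG d)) (F V : Finset ℕ) (H : HG d)
    (hM : Inv F M) (hVF : Disjoint V F) (hH : H ∈ M) (hV : On r V H) :
    ∃ R ∈ M, ∃ W ⊆ V, W.card ≤ 2 * r - 1 ∧ On r W R ∧ wt ∅ R = wt ∅ H := by
  cases r with
  | zero =>
    refine ⟨H, hH, ∅, by simp, by simp, ?_, rfl⟩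
    intro e he
    have := (hV.mem he).2
    simpa using this
  | succ r =>
    induction V using Finset.strongInduction generalizing H with
    | H V ihV =>
      by_cases hc : V.card ≤ 2 * (r + 1) - 1
      · exact ⟨H, hH, V, Subset.refl _, hc, hV, rfl⟩
      · have : V.Nonempty := by rw [← card_pos]; omega
        obtain ⟨v, hv⟩ := this
        obtain ⟨T, h1, h2, h3⟩ := step (claim r) M F V H hM hVF hH hV (by omega) v hv
        obtain ⟨R, a1, W, a2, a3, a4, a5⟩ := ihV (V.erase v) (erase_ssubset hv) (H - T)
          (hVF.mono_left (erase_subset _ _)) (sub_mem hH (gen_le _ _ _ h1))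
          (on_erase (hV.sub (gen_on h1)) (by rw [map_sub, h2, sub_self]))
        exact ⟨R, a1, W, a2.trans (erase_subset _ _), a3, a4, by rw [a5, map_sub, h3, sub_zero]⟩

/-- Iterated product of the differences. -/
noncomputable def P (α β : ℕ → ℕ) : ℕ → (HG d →+ HG d)
  | 0 => AddMonoidHom.id _
  | n+1 => (P α β n).comp (D (α n) (β n))

def AB (α β : ℕ → ℕ) (n : ℕ) : Finset ℕ := (range n).image α ∪ (range n).image β

theorem AB_succ (α β : ℕ → ℕ) (n : ℕ) :
    AB α β (n+1) = insert (α n) (insert (β n) (AB α β n)) := by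
  simp only [AB, range_add_one, image_insert]
  grind

theorem P_comm (α β : ℕ → ℕ) (x y n : ℕ) (K : HG d) :
    P α β n (D x y K) = D x y (P α β n K) := by
  induction n generalizing K with
  | zero => rfl
  | succ n ih => simp only [P, AddMonoidHom.comp_apply]; rw [D_comm, ih]

theorem wt_P_zero (α β : ℕ → ℕ) (n : ℕ) (K : HG d) (X : Finset ℕ) (i : ℕ) (hi : i < n)
    (h1 : α i ∉ X) (h2 : β i ∉ X) : wt X (P α β n K) = 0 := by
  induction n generalizing K with
  | zero => omega
  | succ n ih =>
    simp only [P, AddMonoidHom.comp_apply]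
    rcases Nat.lt_succ_iff_lt_or_eq.1 hi with h | rfl
    · exact ih _ h
    · rw [P_comm]; exact wt_D_zero _ h1 h2 _

theorem on_P {α β : ℕ → ℕ} {r : ℕ} {W : Finset ℕ} (n : ℕ) {K : HG d} (hK : On r W K)
    (hα : Set.InjOn α (range n)) (hβ : Set.InjOn β (range n))
    (hαβ : ∀ i < n, ∀ j < n, α i ≠ β j) (hW : Disjoint W (AB α β n)) :
    On (r + n) (AB α β n ∪ W) (P α β n K) := by
  induction n generalizing r W K with
  | zero => simpa [P, AB] using hK
  | succ n ih =>
    simp only [P, AddMonoidHom.comp_apply]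
    rw [AB_succ] at hW
    have hA : α n ∉ AB α β n := by
      simp only [AB, mem_union, mem_image, mem_range, not_or, not_exists, not_and]
      refine ⟨fun i hi h => ?_, fun i hi h => hαβ n (by omega) i (by omega) h.symm⟩
      have := hα (by simp; omega) (by simp) h
      omega
    have hB : β n ∉ AB α β n := by
      simp only [AB, mem_union, mem_image, mem_range, not_or, not_exists, not_and]
      refine ⟨fun i hi h => hαβ i (by omega) n (by omega) h, fun i hi h => ?_⟩
      have := hβ (by simp; omega) (by simp) h
      omega
    rw [disjoint_left] at hW
    have hK' := on_D hK (x := α n) (y := β n) (by grind) (by grind)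
    have := ih hK' (hα.mono (by simp)) (hβ.mono (by simp))
      (fun i hi j hj => hαβ i (by omega) j (by omega)) (by rw [disjoint_left]; grind)
    rw [AB_succ]
    have e : r + (n + 1) = r + 1 + n := by omega
    rw [e]
    exact this.mono (by grind)

theorem wt_P {α β : ℕ → ℕ} {r : ℕ} {W : Finset ℕ} (n : ℕ) {K : HG d} (hK : On r W K)
    (hα : Set.InjOn α (range n)) (hβ : Set.InjOn β (range n))
    (hαβ : ∀ i < n, ∀ j < n, α i ≠ β j) (hW : Disjoint W (AB α β n))
    (Y : Finset ℕ) (hY : Disjoint Y (AB α β n)) (χ : ℕ → Bool) :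
    wt ((range n).image (fun i => if χ i then β i else α i) ∪ Y) (P α β n K)
      = (∏ i ∈ range n, if χ i then (-1 : ℤ) else 1) • wt Y K := by
  induction n generalizing r W K Y with
  | zero => simp [P]
  | succ n ih =>
    simp only [P, AddMonoidHom.comp_apply]
    rw [AB_succ] at hW hY
    have hA : α n ∉ AB α β n := by
      simp only [AB, mem_union, mem_image, mem_range, not_or, not_exists, not_and]
      refine ⟨fun i hi h => ?_, fun i hi h => hαβ n (by omega) i (by omega) h.symm⟩
      have := hα (by simp; omega) (by simp) h
      omega
    have hB : β n ∉ AB α β n := by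
      simp only [AB, mem_union, mem_image, mem_range, not_or, not_exists, not_and]
      refine ⟨fun i hi h => hαβ i (by omega) n (by omega) h, fun i hi h => ?_⟩
      have := hβ (by simp; omega) (by simp) h
      omega
    have hab : α n ≠ β n := hαβ n (by omega) n (by omega)
    rw [disjoint_left] at hW hY
    have hK' := on_D hK (x := α n) (y := β n) (by grind) (by grind)
    have := ih hK' (hα.mono (by simp)) (hβ.mono (by simp))
      (fun i hi j hj => hαβ i (by omega) j (by omega)) (by rw [disjoint_left]; grind)
      (insert (if χ n then β n else α n) Y) (by rw [disjoint_left]; grind)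
    rw [range_add_one, image_insert, insert_union, ← union_insert, this,
      prod_insert (by simp), mul_comm, mul_smul]
    congr 1
    split_ifs
    · rw [D_swap, map_neg, wt_D_left hK Y (by grind) (by grind) hab.symm, neg_smul, one_smul]
    · rw [wt_D_left hK Y (by grind) (by grind) hab, one_smul]

theorem inv_P {α β : ℕ → ℕ} {M : AddSubgroup (HG d)} (hM : Inv ∅ M) (n : ℕ) :
    Inv (AB α β n) (M.comap (P α β n)) := by
  induction n with
  | zero => intro π _ H hH; exact hM π (by simp) H hH
  | succ n ih =>
    rw [AB_succ]
    exact ih.comap (α n) (β n)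

theorem exists_link {α β : ℕ → ℕ} {M : AddSubgroup (HG d)} (hM : Inv ∅ M) {k : ℕ}
    {V : Finset ℕ} {G : HG d} (hG : G ∈ M) (hV : On k V G) (n : ℕ) (hn : n ≤ k)
    (hα : Set.InjOn α (range n)) (hβ : Set.InjOn β (range n))
    (hαV : ∀ i < n, α i ∈ V) (hβV : ∀ i < n, β i ∉ V) :
    ∃ H ∈ M.comap (P α β n), On (k - n) (V \ AB α β n) H ∧
      ∀ Y, Disjoint Y ((range n).image α) → wt Y H = wt (Y ∪ (range n).image α) G := by
  induction n with
  | zero => exact ⟨G, hG, by simpa [AB] using hV, by simp⟩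
  | succ n ih =>
    obtain ⟨H, h1, h2, h3⟩ := ih (by omega) (hα.mono (by simp)) (hβ.mono (by simp))
      (fun i hi => hαV i (by omega)) (fun i hi => hβV i (by omega))
    have hbV := hβV n (by omega)
    have hA : α n ∉ (range n).image α := by
      simp only [mem_image, mem_range, not_exists, not_and]
      intro i hi h
      have := hα (by simp; omega) (by simp) h
      omega
    have hA' : α n ∉ AB α β n := by
      simp only [AB, mem_union, not_or]
      refine ⟨hA, ?_⟩
      simp only [mem_image, mem_range, not_exists, not_and]
      intro i hi h
      exact hβV i (by omega) (h ▸ hαV n (by omega))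
    have hB' : β n ∉ AB α β n := by
      simp only [AB, mem_union, mem_image, mem_range, not_or, not_exists, not_and]
      refine ⟨fun i hi h => hbV (h ▸ hαV i (by omega)), fun i hi h => ?_⟩
      have := hβ (by simp; omega) (by simp) h
      omega
    refine ⟨link (α n) H, ?_, ?_, ?_⟩
    · have : D (α n) (β n) (link (α n) H) ∈ M.comap (P α β n) := by
        rw [D_link h2 (by grind)]
        refine sub_mem h1 (inv_P hM n _ ?_ _ h1)
        intro x hx
        exact Equiv.swap_apply_of_ne_of_ne (by grind) (by grind)
      exact this
    · have e : k - n = k - (n + 1) + 1 := by omega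
      rw [e] at h2
      refine (on_link h2 (α n)).mono ?_
      rw [AB_succ]
      grind
    · intro Y hY
      rw [range_add_one, image_insert, disjoint_insert_right] at hY
      rw [wt_link _ _ hY.1, h3 _ (disjoint_insert_left.2 ⟨hA, hY.2⟩), range_add_one, image_insert,
        insert_union, union_insert]

theorem inv_span (G : HG d) :
    Inv ∅ (Submodule.span ℤ (Eqs {G})).toAddSubgroup := by
  intro π _ H hH
  rw [Submodule.mem_toAddSubgroup] at hH ⊢
  refine Submodule.span_induction (p := fun H _ => act π H ∈ Submodule.span ℤ (Eqs {G}))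
    ?_ ?_ ?_ ?_ hH
  · rintro K ⟨G', hG', σ, hσ⟩
    refine Submodule.subset_span ⟨G', hG', σ.trans π, fun e => ?_⟩
    rw [← hσ e]
    have : e.image (σ.trans π) = (e.image σ).image π := by rw [image_image]; rfl
    rw [this]
    exact Finsupp.mapDomain_apply (image_injective π.injective) _ _
  · rw [map_zero]; exact zero_mem _
  · intro x y _ _ hx hy; rw [map_add]; exact add_mem hx hy
  · intro c x _ hx; rw [map_zsmul]; exact Submodule.smul_mem _ _ hx

end SH

/-- **Lemma (construction of simple hypergraphs).**
Let `G = (V', μ')` be a `k`-hypergraph of dimension `d` and let `X` be an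
`m`-element subset of `V'` with `m ≤ k`; set `a = w_X(G)`.  Then there exists
an `(m, a)`-simple `k`-hypergraph `S` with `S ∈ Σ_ℤ(Eqs({G}))`. -/
theorem exists_simple_hypergraph
    (k d m : ℕ) (hk : 1 ≤ k) (hd : 1 ≤ d) (hm : m ≤ k)
    (G : HG d) (hG : IsHG k G)
    (V' : Finset ℕ) (hV' : verts G ⊆ V')
    (X : Finset ℕ) (hX : X ⊆ V') (hXcard : X.card = m) :
    ∃ S : HG d, S ∈ Zsum (Eqs {G}) ∧ IsHG k S ∧ IsSimple k m (weight X G) S := by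
  classical
  let M := (Submodule.span ℤ (Eqs {G})).toAddSubgroup
  have hM : SH.Inv ∅ M := SH.inv_span G
  have hGM : G ∈ M := Submodule.subset_span ⟨G, rfl, Equiv.refl _, by simp⟩
  have hV : SH.On k V' G := by
    intro e he
    rw [Finset.mem_powersetCard]
    refine ⟨?_, hG e he⟩
    have : e ⊆ verts G := Finset.le_sup (f := id) he
    exact this.trans hV'
  let α : ℕ → ℕ := fun i => if h : i < m then X.orderEmbOfFin hXcard ⟨i, h⟩ else 0
  let N := V'.sup id + 1
  let β : ℕ → ℕ := fun i => N + i
  have hαv : ∀ i : Fin m, α i = X.orderEmbOfFin hXcard i := by intro i; simp [α]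
  have hα : Set.InjOn α (Finset.range m) := by
    intro i hi j hj h
    have hi' : i < m := by simpa using hi
    have hj' : j < m := by simpa using hj
    have h1 := hαv ⟨i, hi'⟩
    have h2 := hαv ⟨j, hj'⟩
    simp only at h1 h2
    rw [h1, h2] at h
    simpa using (X.orderEmbOfFin hXcard).injective h
  have hβ : Set.InjOn β (Finset.range m) := by
    intro i _ j _ h
    simp only [β] at h
    omega
  have hαX : (Finset.range m).image α = X := by
    apply Finset.eq_of_subset_of_card_le
    · intro x hx
      obtain ⟨i, hi, rfl⟩ := Finset.mem_image.1 hx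
      rw [hαv ⟨i, Finset.mem_range.1 hi⟩]
      exact Finset.orderEmbOfFin_mem _ _ _
    · rw [Finset.card_image_of_injOn hα, Finset.card_range, hXcard]
  have hαV : ∀ i < m, α i ∈ V' := fun i hi =>
    hX (hαX ▸ Finset.mem_image_of_mem α (Finset.mem_range.2 hi))
  have hβV : ∀ i < m, β i ∉ V' := by
    intro i _ h
    have : β i ≤ V'.sup id := Finset.le_sup (f := id) h
    simp only [β, N] at this
    omega
  have hαβ : ∀ i < m, ∀ j < m, α i ≠ β j := fun i hi j hj h => hβV j hj (h ▸ hαV i hi)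
  obtain ⟨H, h1, h2, h3⟩ := SH.exists_link (α := α) (β := β) hM hGM hV m hm hα hβ hαV hβV
  have hwt : SH.wt ∅ H = weight X G := by
    rw [h3 ∅ (by simp), hαX, Finset.empty_union, SH.weight_eq]
  obtain ⟨R, hR, W, hWV, hWc, hRW, hRw⟩ := SH.claim2 (k - m) _ _ _ H (SH.inv_P hM m)
    Finset.sdiff_disjoint h1 h2
  have hWAB : Disjoint W (SH.AB α β m) := Finset.sdiff_disjoint.mono_left hWV
  have hPon := SH.on_P m hRW hα hβ hαβ hWAB
  rw [Nat.sub_add_cancel hm] at hPon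
  have hext : ∃ C : Finset ℕ, W ⊆ C ∧ Disjoint C (SH.AB α β m) ∧ C.card = 2 * (k - m) - 1 := by
    obtain ⟨T, hT, hTc⟩ := Set.Infinite.exists_subset_card_eq
      ((SH.AB α β m).finite_toSet.infinite_compl) (2 * (k - m) - 1)
    obtain ⟨C, hC1, hC2, hC3⟩ := Finset.exists_subsuperset_card_eq
      (s := W) (t := W ∪ T) Finset.subset_union_left hWc
      (hTc.symm.le.trans (Finset.card_le_card Finset.subset_union_right))
    refine ⟨C, hC1, ?_, hC3⟩
    rw [Finset.disjoint_left] at hWAB ⊢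
    intro x hx
    rcases Finset.mem_union.1 (hC2 hx) with h | h
    · exact hWAB h
    · exact fun h' => hT h h'
  obtain ⟨C, hWC, hCAB, hCc⟩ := hext
  refine ⟨SH.P α β m R, ?_, fun e he => (hPon.mem he).2, ?_⟩
  · have : SH.P α β m R ∈ Submodule.span ℤ (Eqs {G}) := hR
    obtain ⟨n, f, g, hfg⟩ := Submodule.mem_span_set'.1 this
    exact ⟨n, f, fun i => g i, fun i => (g i).2, hfg.symm⟩
  have himg : ∀ f : ℕ → ℕ, Finset.image (fun i : Fin m => f i) Finset.univ
      = (Finset.range m).image f := by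
    intro f
    ext x
    simp only [Finset.mem_image, Finset.mem_univ, true_and, Finset.mem_range]
    exact ⟨fun ⟨i, h⟩ => ⟨i, i.2, h⟩, fun ⟨i, hi, h⟩ => ⟨⟨i, hi⟩, h⟩⟩
  have hdisj := hCAB
  rw [SH.AB, Finset.disjoint_union_right] at hdisj
  have hmiss : ∀ Y : Finset ℕ, (∀ i < m, α i ∈ Y ∨ β i ∈ Y) →
      ∃ χ : Fin m → Bool,
        Finset.image (fun i : Fin m => if χ i then β i else α i) Finset.univ ⊆ Y ∧
        (Finset.image (fun i : Fin m => if χ i then β i else α i) Finset.univ).card = m := by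
    intro Y hY
    refine ⟨fun i => decide (α i ∉ Y), ?_, ?_⟩
    · intro x hx
      obtain ⟨i, _, rfl⟩ := Finset.mem_image.1 hx
      have := hY i i.2
      by_cases h : α i ∈ Y
      · simpa [h] using h
      · simpa [h] using this
    · rw [Finset.card_image_of_injective, Finset.card_univ, Fintype.card_fin]
      intro i j hij
      have hi := i.2
      have hj := j.2
      have a1 := hαβ i hi j hj
      have a2 := hαβ j hj i hi
      have a3 : α i = α j → i = j := fun h => Fin.ext (hα (by simp) (by simp) h)
      have a4 : β i = β j → i = j := fun h => Fin.ext (hβ (by simp) (by simp) h)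
      simp only at hij
      split_ifs at hij
      · exact a4 hij
      · exact absurd hij.symm a2
      · exact absurd hij a1
      · exact a3 hij
  refine ⟨(Finset.range m).image α, (Finset.range m).image β, C, fun i => α i, fun i => β i,
    fun i j h => Fin.ext (hα (by simp) (by simp) h),
    fun i j h => Fin.ext (hβ (by simp) (by simp) h), (himg α).symm, (himg β).symm,
    ?_, hdisj.1.symm, hdisj.2.symm, hCc, ?_, ?_, ?_, ?_⟩
  · rw [Finset.disjoint_left]
    intro x hx hx'
    obtain ⟨i, hi, rfl⟩ := Finset.mem_image.1 hx
    obtain ⟨j, hj, h⟩ := Finset.mem_image.1 hx'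
    exact hαβ i (Finset.mem_range.1 hi) j (Finset.mem_range.1 hj) h.symm
  · refine Finset.sup_le fun e he => ?_
    exact (hPon.mem he).1.trans (Finset.union_subset_union (Finset.Subset.refl _) hWC)
  · intro χ
    let χ' : ℕ → Bool := fun i => if h : i < m then χ ⟨i, h⟩ else false
    have hχ : ∀ i : Fin m, χ i = χ' i := by intro i; simp [χ']
    have := SH.wt_P m hRW hα hβ hαβ hWAB ∅ (by simp) χ'
    rw [hRw, hwt, Finset.union_empty, ← himg, ← SH.weight_eq, Finset.prod_range] at this
    simp only [hχ]
    rw [this]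
    congr 1
    rw [Finset.prod_ite]
    simp
  · intro Y _ hYc hY
    rw [SH.weight_eq]
    by_contra hne
    have : ∀ i < m, α i ∈ Y ∨ β i ∈ Y := by
      intro i hi
      by_contra hcon
      rw [not_or] at hcon
      exact hne (SH.wt_P_zero α β m R Y i hi hcon.1 hcon.2)
    obtain ⟨χ, c1, c2⟩ := hmiss Y this
    exact hY χ (Finset.eq_of_subset_of_card_le c1 (by rw [c2, hYc])).symm
  · intro Y _ hYc
    rw [SH.weight_eq]
    by_contra hne
    have : ∀ i < m, α i ∈ Y ∨ β i ∈ Y := by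
      intro i hi
      by_contra hcon
      rw [not_or] at hcon
      exact hne (SH.wt_P_zero α β m R Y i hi hcon.1 hcon.2)
    obtain ⟨χ, c1, c2⟩ := hmiss Y this
    have := Finset.card_le_card c1
    omega
end
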